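/- arXiv:0906.0226 — 8 statements merged into one kernel-verified Lean document; each statement's English description precedes it below -/
import Mathlib

section
/- For φ ∈ (−π, π], the spectrum of the bounded linear operator Θ_φ = Id − i·sin(φ)·A on the complex Hilbert space L²(ℝ, ℂ) equals the set {1 − sin φ, 1 + sin φ}. -/
open MeasureTheory Filter Topology
open scoped Pointwise

theorem spectrum_eq_of_mul_self_eq_one {𝕜 R : Type*} [Field 𝕜] [Ring R] [Algebra 𝕜 R] {a : R}
    (h : a * a = 1) (h₁ : a ≠ 1) (h₂ : a ≠ -1) : spectrum 𝕜 a = {1, -1} := by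
  have : Nontrivial R := ⟨⟨a, 1, h₁⟩⟩
  ext k
  simp only [Set.mem_insert_iff, Set.mem_singleton_iff]
  constructor
  · intro hk
    have hk2 := spectrum.pow_mem_pow a 2 hk
    rw [pow_two a, h, spectrum.one_eq, Set.mem_singleton_iff] at hk2
    exact by simpa using hk2
  · rintro (rfl | rfl) hu
    · rw [spectrum.mem_resolventSet_iff, map_one] at hu
      refine h₂ (eq_neg_of_add_eq_zero_right (hu.mul_left_cancel (c := 0) ?_))
      rw [mul_zero]
      noncomm_ring [h]
    · rw [spectrum.mem_resolventSet_iff, map_neg, map_one] at hu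
      refine h₁ (sub_eq_zero.1 (hu.mul_left_cancel (c := 0) ?_))
      rw [mul_zero]
      noncomm_ring [h]

theorem signedReflection_mul_self
    {A : Lp ℂ 2 (volume : Measure ℝ) →L[ℂ] Lp ℂ 2 (volume : Measure ℝ)}
    (hA : ∀ ψ : Lp ℂ 2 (volume : Measure ℝ),
      (A ψ : ℝ → ℂ) =ᵐ[volume] fun x : ℝ => (Real.sign x : ℂ) * ψ (-x)) :
    A * A = -1 := by
  refine ContinuousLinearMap.ext fun ψ => Lp.ext ?_
  change (A (A ψ) : ℝ → ℂ) =ᵐ[volume] (-ψ : Lp ℂ 2 (volume : Measure ℝ))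
  have hneg := (Measure.measurePreserving_neg (volume : Measure ℝ)).quasiMeasurePreserving.ae (hA ψ)
  filter_upwards [hA (A ψ), hneg, Lp.coeFn_neg ψ, Measure.ae_ne volume (0 : ℝ)]
    with x h₁ h₂ h₃ hx
  rw [h₁, h₂, h₃, neg_neg, Real.sign_neg, Pi.neg_apply]
  rcases hx.lt_or_gt with hx | hx
  · simp [Real.sign_of_neg hx]
  · simp [Real.sign_of_pos hx]

theorem signedReflection_ne_smul_one
    {A : Lp ℂ 2 (volume : Measure ℝ) →L[ℂ] Lp ℂ 2 (volume : Measure ℝ)}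
    (hA : ∀ ψ : Lp ℂ 2 (volume : Measure ℝ),
      (A ψ : ℝ → ℂ) =ᵐ[volume] fun x : ℝ => (Real.sign x : ℂ) * ψ (-x))
    {c : ℂ} (hc : c ≠ 0) : A ≠ c • 1 := by
  rintro rfl
  have hfin : volume (Set.Ioo (0 : ℝ) 1) ≠ ⊤ := by simp
  let ψ : Lp ℂ 2 (volume : Measure ℝ) := indicatorConstLp 2 measurableSet_Ioo hfin (1 : ℂ)
  have hψ : (ψ : ℝ → ℂ) =ᵐ[volume] (Set.Ioo (0 : ℝ) 1).indicator fun _ => (1 : ℂ) :=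
    indicatorConstLp_coeFn
  have hneg := (Measure.measurePreserving_neg (volume : Measure ℝ)).quasiMeasurePreserving.ae hψ
  have hnot : ∀ᵐ x : ℝ, x ∉ Set.Ioo (0 : ℝ) 1 := by
    filter_upwards [hA ψ, Lp.coeFn_smul c ψ, hψ, hneg] with x h₁ h₂ h₃ h₄ hx
    change (c • ψ : Lp ℂ 2 (volume : Measure ℝ)) x = _ at h₁
    rw [h₂, h₄, Pi.smul_apply, h₃, Set.indicator_of_mem hx,
      Set.indicator_of_notMem fun h => by linarith [h.1, hx.1]] at h₁
    simp [hc] at h₁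
  have hzero : volume (Set.Ioo (0 : ℝ) 1) = 0 := measure_eq_zero_iff_ae_notMem.2 hnot
  simp at hzero

/-- For `φ ∈ (-π, π]`, the spectrum of the bounded operator
`Θ_φ = Id - i sin(φ) A` on `L²(ℝ, ℂ)` equals `{1 - sin φ, 1 + sin φ}`. -/
theorem surprising_spectra_stmt7
    (φ : ℝ) (hφ : φ ∈ Set.Ioc (-Real.pi) Real.pi)
    (A : Lp ℂ 2 (volume : Measure ℝ) →L[ℂ] Lp ℂ 2 (volume : Measure ℝ))
    (hA : ∀ ψ : Lp ℂ 2 (volume : Measure ℝ),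
      (A ψ : ℝ → ℂ) =ᵐ[volume] fun x : ℝ => (Real.sign x : ℂ) * ψ (-x))
    (Θ : Lp ℂ 2 (volume : Measure ℝ) →L[ℂ] Lp ℂ 2 (volume : Measure ℝ))
    (hΘ : Θ = ContinuousLinearMap.id ℂ (Lp ℂ 2 (volume : Measure ℝ))
      - (Complex.I * (Real.sin φ : ℂ)) • A) :
    spectrum ℂ Θ = {(1 - Real.sin φ : ℂ), (1 + Real.sin φ : ℂ)} := by
  have hI : A = -Complex.I • (Complex.I • A) := by simp [smul_smul]
  have hsq : (Complex.I • A) * (Complex.I • A) = 1 := by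
    rw [smul_mul_smul_comm, signedReflection_mul_self hA]
    simp
  have h₁ : Complex.I • A ≠ 1 := fun h =>
    signedReflection_ne_smul_one hA (neg_ne_zero.2 Complex.I_ne_zero) (by rw [← h]; exact hI)
  have h₂ : Complex.I • A ≠ -1 := fun h =>
    signedReflection_ne_smul_one hA Complex.I_ne_zero (by rw [hI, h]; simp)
  have : Nontrivial (Lp ℂ 2 (volume : Measure ℝ) →L[ℂ] Lp ℂ 2 (volume : Measure ℝ)) :=
    ⟨⟨_, _, h₁⟩⟩
  have hspec := spectrum_eq_of_mul_self_eq_one (𝕜 := ℂ) hsq h₁ h₂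
  have hΘ' : Θ = algebraMap ℂ _ 1 - (Real.sin φ : ℂ) • (Complex.I • A) := by
    rw [hΘ, map_one, smul_smul, mul_comm]
    rfl
  rw [hΘ', ← spectrum.singleton_sub_eq,
    spectrum.smul_eq_smul _ _ (by rw [hspec]; exact Set.insert_nonempty _ _), hspec]
  simp [Set.smul_set_insert, Set.image_insert_eq]
end

section
/- Let φ ∈ (−π, π] and let ψ : ℝ∖{0} → ℂ be differentiable with one-sided limits ψ(0±) and ψ'(0±) existing and satisfying ψ(0+) = e^{iφ}ψ(0−) and ψ'(0+) = e^{−iφ}ψ'(0−). Define η(x) = ψ(x) − i·sin(φ)·sign(x)·ψ(−x) for x ≠ 0. Then η is differentiable on ℝ∖{0}, its one-sided limits at 0 exist and satisfy the adjoint boundary conditions η(0+) = e^{−iφ}η(0−) and η'(0+) = e^{iφ}η'(0−). (This is the boundary-condition form of the intertwining relation L_φ* Θ_φ = Θ_φ L_φ.) -/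
open MeasureTheory Filter Topology

theorem hasDerivAt_sub_const_mul_sign_mul_comp_neg {ψ dψ : ℝ → ℂ} (a : ℂ)
    (hder : ∀ x : ℝ, x ≠ 0 → HasDerivAt ψ (dψ x) x) {x : ℝ} (hx : x ≠ 0) :
    HasDerivAt (fun y : ℝ => ψ y - a * (Real.sign y : ℂ) * ψ (-y))
      (dψ x + a * (Real.sign x : ℂ) * dψ (-x)) x := by
  have hneg : HasDerivAt (fun y : ℝ => ψ (-y)) (-dψ (-x)) x := by
    simpa [Function.comp_def] using (hder (-x) (neg_ne_zero.mpr hx)).scomp x (hasDerivAt_neg x)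
  have hconst := (hder x hx).sub (hneg.const_mul (a * (Real.sign x : ℂ)))
  have hsign : ∀ᶠ y in 𝓝 x, Real.sign y = Real.sign x := by
    rcases lt_or_gt_of_ne hx with h | h
    · filter_upwards [Iio_mem_nhds h] with y hy
      rw [Real.sign_of_neg hy, Real.sign_of_neg h]
    · filter_upwards [Ioi_mem_nhds h] with y hy
      rw [Real.sign_of_pos hy, Real.sign_of_pos h]
  have h := hconst.congr_of_eventuallyEq
    (f₁ := fun y : ℝ => ψ y - a * (Real.sign y : ℂ) * ψ (-y))
    (hsign.mono fun y hy => by simp [hy])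
  rwa [mul_neg, sub_neg_eq_add] at h

theorem tendsto_add_const_mul_sign_mul_comp_neg {f : ℝ → ℂ} {p m : ℂ} (a : ℂ)
    (hp : Tendsto f (𝓝[>] (0 : ℝ)) (𝓝 p)) (hm : Tendsto f (𝓝[<] (0 : ℝ)) (𝓝 m)) :
    Tendsto (fun x : ℝ => f x + a * (Real.sign x : ℂ) * f (-x)) (𝓝[>] (0 : ℝ))
        (𝓝 (p + a * m)) ∧
      Tendsto (fun x : ℝ => f x + a * (Real.sign x : ℂ) * f (-x)) (𝓝[<] (0 : ℝ))
        (𝓝 (m - a * p)) := by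
  have hnegp : Tendsto (fun x : ℝ => -x) (𝓝[>] (0 : ℝ)) (𝓝[<] (0 : ℝ)) := by
    simpa using tendsto_neg_nhdsGT (a := (0 : ℝ))
  have hnegm : Tendsto (fun x : ℝ => -x) (𝓝[<] (0 : ℝ)) (𝓝[>] (0 : ℝ)) := by
    simpa using tendsto_neg_nhdsLT (a := (0 : ℝ))
  constructor
  · refine (hp.add ((hm.comp hnegp).const_mul a)).congr' ?_
    filter_upwards [self_mem_nhdsWithin] with x hx
    simp [Real.sign_of_pos hx]
  · refine (hm.sub ((hp.comp hnegm).const_mul a)).congr' ?_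
    filter_upwards [self_mem_nhdsWithin] with x hx
    simp [Real.sign_of_neg hx, sub_eq_add_neg]

/-- If `ψ` satisfies the point-interaction boundary conditions
`ψ(0+) = e^{iφ} ψ(0-)`, `ψ'(0+) = e^{-iφ} ψ'(0-)`, then
`η(x) = ψ(x) - i sin(φ) sign(x) ψ(-x)` is differentiable on `ℝ ∖ {0}`, its one-sided
limits at 0 exist, and they satisfy the adjoint boundary conditions
`η(0+) = e^{-iφ} η(0-)`, `η'(0+) = e^{iφ} η'(0-)`. -/
theorem surprising_spectra_stmt9
    (φ : ℝ) (hφ : φ ∈ Set.Ioc (-Real.pi) Real.pi)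
    (ψ dψ : ℝ → ℂ) (ψ0p ψ0m dψ0p dψ0m : ℂ)
    (hder : ∀ x : ℝ, x ≠ 0 → HasDerivAt ψ (dψ x) x)
    (hp : Tendsto ψ (𝓝[>] (0:ℝ)) (𝓝 ψ0p)) (hm : Tendsto ψ (𝓝[<] (0:ℝ)) (𝓝 ψ0m))
    (hdp : Tendsto dψ (𝓝[>] (0:ℝ)) (𝓝 dψ0p)) (hdm : Tendsto dψ (𝓝[<] (0:ℝ)) (𝓝 dψ0m))
    (hbc1 : ψ0p = Complex.exp (Complex.I * φ) * ψ0m)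
    (hbc2 : dψ0p = Complex.exp (-(Complex.I * φ)) * dψ0m)
    (η : ℝ → ℂ)
    (hη : η = fun x : ℝ =>
      ψ x - Complex.I * (Real.sin φ : ℂ) * (Real.sign x : ℂ) * ψ (-x)) :
    (∀ x : ℝ, x ≠ 0 → DifferentiableAt ℝ η x) ∧
    ∃ η0p η0m dη0p dη0m : ℂ,
      Tendsto η (𝓝[>] (0:ℝ)) (𝓝 η0p) ∧ Tendsto η (𝓝[<] (0:ℝ)) (𝓝 η0m) ∧
      Tendsto (deriv η) (𝓝[>] (0:ℝ)) (𝓝 dη0p) ∧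
      Tendsto (deriv η) (𝓝[<] (0:ℝ)) (𝓝 dη0m) ∧
      η0p = Complex.exp (-(Complex.I * φ)) * η0m ∧
      dη0p = Complex.exp (Complex.I * φ) * dη0m := by
  subst hη
  set a : ℂ := Complex.I * (Real.sin φ : ℂ) with ha
  have hder' := fun x hx =>
    hasDerivAt_sub_const_mul_sign_mul_comp_neg a hder (x := x) hx
  obtain ⟨h₁, h₂⟩ := tendsto_add_const_mul_sign_mul_comp_neg (-a) hp hm
  obtain ⟨h₃, h₄⟩ := tendsto_add_const_mul_sign_mul_comp_neg a hdp hdm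
  have he : Complex.exp (Complex.I * φ) = Complex.cos φ + a := by
    rw [mul_comm, Complex.exp_mul_I, ha, Complex.ofReal_sin, mul_comm Complex.I]
  have he' : Complex.exp (-(Complex.I * φ)) = Complex.cos φ - a := by
    rw [← mul_neg, mul_comm, Complex.exp_mul_I, ha, Complex.ofReal_sin, Complex.cos_neg,
      Complex.sin_neg]
    ring
  have hmul : (Complex.cos φ + a) * (Complex.cos φ - a) = 1 := by
    rw [← he, ← he', ← Complex.exp_add, add_neg_cancel, Complex.exp_zero]
  refine ⟨fun x hx => (hder' x hx).differentiableAt, _, _, _, _,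
    h₁.congr fun x => by ring, h₂.congr fun x => by ring, h₃.congr' ?_, h₄.congr' ?_, ?_, ?_⟩
  · filter_upwards [self_mem_nhdsWithin] with x hx
    exact (hder' x (ne_of_gt hx)).deriv.symm
  · filter_upwards [self_mem_nhdsWithin] with x hx
    exact (hder' x (ne_of_lt hx)).deriv.symm
  · rw [hbc1, he, he']
    linear_combination (-a * ψ0m) * hmul
  · rw [hbc2, he, he']
    linear_combination (a * dψ0m) * hmul
end

section
/- Let b ≥ 0 and c ∈ ℝ with 1 + bc ≥ 0, let φ ∈ (−π, π], and let B be the 2×2 complex matrix with rows (√(1+bc)·e^{iφ}, b) and (c, √(1+bc)·e^{−iφ}). Suppose ψ : ℝ∖{0} → ℂ is differentiable, its one-sided limits ψ(0±), ψ'(0±) exist, and (ψ(0+), ψ'(0+))ᵀ = B·(ψ(0−), ψ'(0−))ᵀ. Then the function η(x) = conj(ψ(−x)) is differentiable on ℝ∖{0}, its one-sided limits at 0 exist, and (η(0+), η'(0+))ᵀ = B·(η(0−), η'(0−))ᵀ. (PT-symmetry of the connected point interaction with θ = 0.) -/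
open MeasureTheory Filter Topology

/-- The boundary conditions of the connected point interaction with `θ = 0` are invariant under
`(u, v) ↦ (conj u, -conj v)` combined with the exchange of the two sides of the origin. -/
theorem conj_boundary_condition {b c φ : ℝ} (hbc : 0 ≤ 1 + b * c) {u v p q : ℂ}
    (hp : p = (Real.sqrt (1 + b * c) : ℂ) * Complex.exp (Complex.I * φ) * u + b * v)
    (hq : q = c * u + (Real.sqrt (1 + b * c) : ℂ) * Complex.exp (-(Complex.I * φ)) * v) :
    (starRingEnd ℂ) u = (Real.sqrt (1 + b * c) : ℂ) * Complex.exp (Complex.I * φ) *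
        (starRingEnd ℂ) p + b * -(starRingEnd ℂ) q ∧
      -(starRingEnd ℂ) v = c * (starRingEnd ℂ) p +
        (Real.sqrt (1 + b * c) : ℂ) * Complex.exp (-(Complex.I * φ)) * -(starRingEnd ℂ) q := by
  have hs : (Real.sqrt (1 + b * c) : ℂ) * (Real.sqrt (1 + b * c) : ℂ) = 1 + b * c := by
    exact_mod_cast Real.mul_self_sqrt hbc
  have he : Complex.exp (Complex.I * φ) * Complex.exp (-(Complex.I * φ)) = 1 := by
    rw [← Complex.exp_add, add_neg_cancel, Complex.exp_zero]
  subst hp hq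
  simp only [map_add, map_mul, map_neg, Complex.conj_ofReal, ← Complex.exp_conj, Complex.conj_I,
    neg_mul, neg_neg]
  generalize (Real.sqrt (1 + b * c) : ℂ) = s at *
  generalize Complex.exp (Complex.I * φ) = e at *
  generalize Complex.exp (-(Complex.I * φ)) = f at *
  constructor
  · linear_combination -(starRingEnd ℂ) u * (s * s * he + hs)
  · linear_combination (starRingEnd ℂ) v * (s * s * he + hs)

/-- PT-symmetry of the connected point interaction with `θ = 0`: if `ψ`
satisfies the boundary conditions `(ψ(0+), ψ'(0+))ᵀ = B (ψ(0-), ψ'(0-))ᵀ` with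
`B = [[√(1+bc) e^{iφ}, b], [c, √(1+bc) e^{-iφ}]]`, then `η(x) = conj(ψ(-x))` is
differentiable off 0, has one-sided limits at 0, and satisfies the same boundary
conditions `(η(0+), η'(0+))ᵀ = B (η(0-), η'(0-))ᵀ`. -/
theorem surprising_spectra_stmt10
    (b c : ℝ) (hb : 0 ≤ b) (hbc : 0 ≤ 1 + b * c)
    (φ : ℝ) (hφ : φ ∈ Set.Ioc (-Real.pi) Real.pi)
    (B : Matrix (Fin 2) (Fin 2) ℂ)
    (hB : B = !![(Real.sqrt (1 + b * c) : ℂ) * Complex.exp (Complex.I * φ), (b : ℂ);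
                 (c : ℂ), (Real.sqrt (1 + b * c) : ℂ) * Complex.exp (-(Complex.I * φ))])
    (ψ dψ : ℝ → ℂ) (ψ0p ψ0m dψ0p dψ0m : ℂ)
    (hder : ∀ x : ℝ, x ≠ 0 → HasDerivAt ψ (dψ x) x)
    (hp : Tendsto ψ (𝓝[>] (0:ℝ)) (𝓝 ψ0p)) (hm : Tendsto ψ (𝓝[<] (0:ℝ)) (𝓝 ψ0m))
    (hdp : Tendsto dψ (𝓝[>] (0:ℝ)) (𝓝 dψ0p)) (hdm : Tendsto dψ (𝓝[<] (0:ℝ)) (𝓝 dψ0m))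
    (hbc' : ![ψ0p, dψ0p] = B.mulVec ![ψ0m, dψ0m])
    (η : ℝ → ℂ) (hη : η = fun x : ℝ => (starRingEnd ℂ) (ψ (-x))) :
    -- η is differentiable on ℝ ∖ {0} with derivative -conj(ψ'(-x))
    (∀ x : ℝ, x ≠ 0 → HasDerivAt η (-((starRingEnd ℂ) (dψ (-x)))) x) ∧
    -- its one-sided limits at 0 exist: η(0±) = conj ψ(0∓), η'(0±) = -conj ψ'(0∓)
    Tendsto η (𝓝[>] (0:ℝ)) (𝓝 ((starRingEnd ℂ) ψ0m)) ∧
    Tendsto η (𝓝[<] (0:ℝ)) (𝓝 ((starRingEnd ℂ) ψ0p)) ∧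
    Tendsto (fun x : ℝ => -((starRingEnd ℂ) (dψ (-x)))) (𝓝[>] (0:ℝ))
      (𝓝 (-((starRingEnd ℂ) dψ0m))) ∧
    Tendsto (fun x : ℝ => -((starRingEnd ℂ) (dψ (-x)))) (𝓝[<] (0:ℝ))
      (𝓝 (-((starRingEnd ℂ) dψ0p))) ∧
    -- and (η(0+), η'(0+))ᵀ = B (η(0-), η'(0-))ᵀ
    ![(starRingEnd ℂ) ψ0m, -((starRingEnd ℂ) dψ0m)] =
      B.mulVec ![(starRingEnd ℂ) ψ0p, -((starRingEnd ℂ) dψ0p)] := by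
  have hpos : Tendsto (fun x : ℝ => -x) (𝓝[>] 0) (𝓝[<] 0) := by
    simpa using tendsto_neg_nhdsGT (a := (0 : ℝ))
  have hneg : Tendsto (fun x : ℝ => -x) (𝓝[<] 0) (𝓝[>] 0) := by
    simpa using tendsto_neg_nhdsLT (a := (0 : ℝ))
  have hconj (z : ℂ) : Tendsto (starRingEnd ℂ) (𝓝 z) (𝓝 ((starRingEnd ℂ) z)) :=
    Complex.continuous_conj.tendsto z
  subst hη
  refine ⟨fun x hx => ?_, (hconj _).comp (hm.comp hpos), (hconj _).comp (hp.comp hneg),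
    ((hconj _).comp (hdm.comp hpos)).neg, ((hconj _).comp (hdp.comp hneg)).neg, ?_⟩
  · have h := ((hder (-x) (neg_ne_zero.mpr hx)).scomp x (hasDerivAt_neg x)).star
    simpa [Function.comp_def] using h
  · subst hB
    have h0 := congrFun hbc' 0
    have h1 := congrFun hbc' 1
    simp only [Matrix.mulVec, dotProduct, Fin.sum_univ_two, Matrix.of_apply, Matrix.cons_val_zero,
      Matrix.cons_val_one] at h0 h1
    obtain ⟨hu, hv⟩ := conj_boundary_condition hbc h0 h1
    ext i
    fin_cases i
    · simpa [Matrix.mulVec, dotProduct] using hu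
    · simpa [Matrix.mulVec, dotProduct] using hv
end

section
/- Let l > 0, ε ∈ {1, −1}, and λ ∈ ℂ. Then there exists a (επ/2, λ)-eigenfunction ψ on (−l, l) satisfying the Dirichlet conditions ψ(−l) = 0 and ψ(l) = 0. Explicitly, if λ = k² with k ≠ 0 one may take ψ(x) = sin(k(x+l)) for x ∈ [−l, 0) and ψ(x) = −εi·sin(k(x−l)) for x ∈ (0, l], while for λ = 0 one may take ψ(x) = x + l for x ∈ [−l, 0) and ψ(x) = −εi·(x − l) for x ∈ (0, l]. Consequently the point spectrum of −d²/dx² on (−l,l) with the point interaction ψ(0+) = e^{iεπ/2}ψ(0−), ψ'(0+) = e^{−iεπ/2}ψ'(0−) and Dirichlet conditions at ±l is the entire complex plane ℂ. -/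
open MeasureTheory Filter Topology

/-- A `(φ, λ)`-eigenfunction on `(-l, l)`: `ψ` (with derivative `dψ`) is not identically
zero, is twice continuously differentiable on `[-l, 0)` and on `(0, l]`, satisfies
`-ψ'' = λ ψ` there, its one-sided limits at `0` exist and satisfy the point-interaction
boundary conditions `ψ(0+) = e^{iφ} ψ(0-)`, `ψ'(0+) = e^{-iφ} ψ'(0-)`. -/
def IsEigenfun (l φr : ℝ) (lam : ℂ) (ψ dψ : ℝ → ℂ) : Prop :=
  (∃ x : ℝ, (x ∈ Set.Icc (-l) l ∧ x ≠ 0) ∧ ψ x ≠ 0) ∧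
  (∀ x ∈ Set.Ico (-l) (0:ℝ), HasDerivWithinAt ψ (dψ x) (Set.Ico (-l) 0) x) ∧
  (∀ x ∈ Set.Ico (-l) (0:ℝ), HasDerivWithinAt dψ (-lam * ψ x) (Set.Ico (-l) 0) x) ∧
  (∀ x ∈ Set.Ioc (0:ℝ) l, HasDerivWithinAt ψ (dψ x) (Set.Ioc 0 l) x) ∧
  (∀ x ∈ Set.Ioc (0:ℝ) l, HasDerivWithinAt dψ (-lam * ψ x) (Set.Ioc 0 l) x) ∧
  ∃ ψ0p ψ0m dψ0p dψ0m : ℂ,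
    Filter.Tendsto ψ (nhdsWithin 0 (Set.Ioi 0)) (nhds ψ0p) ∧
    Filter.Tendsto ψ (nhdsWithin 0 (Set.Iio 0)) (nhds ψ0m) ∧
    Filter.Tendsto dψ (nhdsWithin 0 (Set.Ioi 0)) (nhds dψ0p) ∧
    Filter.Tendsto dψ (nhdsWithin 0 (Set.Iio 0)) (nhds dψ0m) ∧
    ψ0p = Complex.exp (Complex.I * φr) * ψ0m ∧
    dψ0p = Complex.exp (-(Complex.I * φr)) * dψ0m

open Complex in
lemma exp_I_mul_sign_mul_pi_div_two {ε : ℝ} (hε : ε = 1 ∨ ε = -1) :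
    exp (I * ((ε * Real.pi / 2 : ℝ) : ℂ)) = ε * I ∧
      exp (-(I * ((ε * Real.pi / 2 : ℝ) : ℂ))) = -(ε * I) := by
  have h₁ : exp (I * (Real.pi / 2)) = I := by
    rw [mul_comm, exp_pi_div_two_mul_I]
  have h₂ : exp (-(I * (Real.pi / 2))) = -I := by
    rw [exp_neg, h₁, inv_I]
  rcases hε with rfl | rfl
  · simp [h₁, h₂]
  · simp [neg_div, h₁, h₂]

/-- Two global solutions `u` and `v` of the eigenvalue equation, matched at `0` by the point
interaction, glue to an eigenfunction as soon as the derivative of `u` does not vanish at the left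
endpoint. -/
lemma isEigenfun_ite {l φr : ℝ} (hl : 0 < l) {lam : ℂ} {u du v dv : ℝ → ℂ}
    (hu : ∀ x, HasDerivAt u (du x) x) (hdu : ∀ x, HasDerivAt du (-lam * u x) x)
    (hv : ∀ x, HasDerivAt v (dv x) x) (hdv : ∀ x, HasDerivAt dv (-lam * v x) x)
    (hne : du (-l) ≠ 0)
    (h₀ : v 0 = Complex.exp (Complex.I * φr) * u 0)
    (h₁ : dv 0 = Complex.exp (-(Complex.I * φr)) * du 0) :
    IsEigenfun l φr lam (fun x => if x < 0 then u x else v x)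
      (fun x => if x < 0 then du x else dv x) := by
  have left (f g : ℝ → ℂ) : Set.EqOn (fun x => if x < 0 then f x else g x) f (Set.Iio 0) :=
    fun x hx => if_pos hx
  have right (f g : ℝ → ℂ) : Set.EqOn (fun x => if x < 0 then f x else g x) g (Set.Ioi 0) :=
    fun x hx => if_neg (not_lt.2 (le_of_lt hx))
  have limL {f g : ℝ → ℂ} (hf : ContinuousAt f 0) :
      Tendsto (fun x => if x < 0 then f x else g x) (𝓝[<] 0) (𝓝 (f 0)) :=
    (hf.tendsto.mono_left nhdsWithin_le_nhds).congr'
      ((left f g).symm.eventuallyEq_of_mem self_mem_nhdsWithin)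
  have limR {f g : ℝ → ℂ} (hg : ContinuousAt g 0) :
      Tendsto (fun x => if x < 0 then f x else g x) (𝓝[>] 0) (𝓝 (g 0)) :=
    (hg.tendsto.mono_left nhdsWithin_le_nhds).congr'
      ((right f g).symm.eventuallyEq_of_mem self_mem_nhdsWithin)
  have subL : Set.Ico (-l) 0 ⊆ Set.Iio 0 := fun x hx => hx.2
  have subR : Set.Ioc 0 l ⊆ Set.Ioi 0 := fun x hx => hx.1
  refine ⟨?_, fun x hx => ?_, fun x hx => ?_, fun x hx => ?_, fun x hx => ?_,
    v 0, u 0, dv 0, du 0, limR (hv 0).continuousAt, limL (hu 0).continuousAt,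
    limR (hdv 0).continuousAt, limL (hdu 0).continuousAt, h₀, h₁⟩
  · by_contra! h
    have hmem : -l ∈ Set.Ico (-l) 0 := ⟨le_rfl, neg_lt_zero.2 hl⟩
    have hz : Set.EqOn u (fun _ => 0) (Set.Ico (-l) 0) := fun x hx => by
      rw [← left u v (subL hx)]
      exact h x ⟨⟨hx.1, (hx.2.trans hl).le⟩, hx.2.ne⟩
    exact hne ((uniqueDiffOn_Ico (-l) 0 _ hmem).eq_deriv _ (hu (-l)).hasDerivWithinAt
      ((hasDerivWithinAt_const (-l) _ (0 : ℂ)).congr hz (hz hmem)))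
  · simpa only [if_pos hx.2] using
      (hu x).hasDerivWithinAt.congr ((left u v).mono subL) (left u v (subL hx))
  · simpa only [if_pos hx.2] using
      (hdu x).hasDerivWithinAt.congr ((left du dv).mono subL) (left du dv (subL hx))
  · simpa only [if_neg (not_lt.2 hx.1.le)] using
      (hv x).hasDerivWithinAt.congr ((right u v).mono subR) (right u v (subR hx))
  · simpa only [if_neg (not_lt.2 hx.1.le)] using
      (hdv x).hasDerivWithinAt.congr ((right du dv).mono subR) (right du dv (subR hx))

lemma hasDerivAt_mul_add_ofReal (k a : ℂ) (x : ℝ) :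
    HasDerivAt (fun x : ℝ => k * ((x : ℂ) + a)) k x := by
  simpa using ((hasDerivAt_id x).ofReal_comp.add_const a).const_mul k

lemma hasDerivAt_sin_mul_add_ofReal (k a : ℂ) (x : ℝ) :
    HasDerivAt (fun x : ℝ => Complex.sin (k * ((x : ℂ) + a)))
      (k * Complex.cos (k * ((x : ℂ) + a))) x := by
  exact ((Complex.hasDerivAt_sin _).comp x (hasDerivAt_mul_add_ofReal k a x)).congr_deriv
    (mul_comm _ _)

lemma hasDerivAt_mul_cos_mul_add_ofReal (k a : ℂ) (x : ℝ) :
    HasDerivAt (fun x : ℝ => k * Complex.cos (k * ((x : ℂ) + a)))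
      (-k ^ 2 * Complex.sin (k * ((x : ℂ) + a))) x := by
  refine (((Complex.hasDerivAt_cos _).comp x
    (hasDerivAt_mul_add_ofReal k a x)).const_mul k).congr_deriv ?_
  ring

/-- For the point interaction `φ = επ/2` with Dirichlet conditions at `±l`,
every `λ ∈ ℂ` is an eigenvalue; explicit eigenfunctions are
`ψ(x) = sin(k(x+l))` / `-εi sin(k(x-l))` for `λ = k² ≠ 0` and `x+l` / `-εi(x-l)` for
`λ = 0`. Hence the point spectrum is the entire complex plane. -/
theorem surprising_spectra_stmt14
    (l : ℝ) (hl : 0 < l) (ε : ℝ) (hε : ε = 1 ∨ ε = -1) :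
    -- explicit eigenfunction for λ = k², k ≠ 0
    (∀ k : ℂ, k ≠ 0 →
      IsEigenfun l (ε * Real.pi / 2) (k ^ 2)
        (fun x : ℝ => if x < 0 then Complex.sin (k * (x + l))
          else -(ε : ℂ) * Complex.I * Complex.sin (k * (x - l)))
        (fun x : ℝ => if x < 0 then k * Complex.cos (k * (x + l))
          else -(ε : ℂ) * Complex.I * k * Complex.cos (k * (x - l))) ∧
      (if (-l : ℝ) < 0 then Complex.sin (k * ((-l : ℝ) + l))
          else -(ε : ℂ) * Complex.I * Complex.sin (k * ((-l : ℝ) - l))) = 0 ∧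
      (if (l : ℝ) < 0 then Complex.sin (k * ((l : ℝ) + l))
          else -(ε : ℂ) * Complex.I * Complex.sin (k * ((l : ℝ) - l))) = 0) ∧
    -- explicit eigenfunction for λ = 0
    (IsEigenfun l (ε * Real.pi / 2) 0
        (fun x : ℝ => if x < 0 then ((x : ℂ) + l) else -(ε : ℂ) * Complex.I * ((x : ℂ) - l))
        (fun x : ℝ => if x < 0 then 1 else -(ε : ℂ) * Complex.I) ∧
      (if (-l : ℝ) < 0 then (((-l : ℝ) : ℂ) + l)
          else -(ε : ℂ) * Complex.I * (((-l : ℝ) : ℂ) - l)) = 0 ∧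
      (if (l : ℝ) < 0 then (((l : ℝ) : ℂ) + l)
          else -(ε : ℂ) * Complex.I * (((l : ℝ) : ℂ) - l)) = 0) ∧
    -- consequently the point spectrum with Dirichlet conditions at ±l is all of ℂ
    (∀ lam : ℂ, ∃ ψ dψ : ℝ → ℂ,
      IsEigenfun l (ε * Real.pi / 2) lam ψ dψ ∧ ψ (-l) = 0 ∧ ψ l = 0) := by
  obtain ⟨hexp, hexp'⟩ := exp_I_mul_sign_mul_pi_div_two hε
  have trig : ∀ k : ℂ, k ≠ 0 →
      IsEigenfun l (ε * Real.pi / 2) (k ^ 2)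
        (fun x : ℝ => if x < 0 then Complex.sin (k * (x + l))
          else -(ε : ℂ) * Complex.I * Complex.sin (k * (x - l)))
        (fun x : ℝ => if x < 0 then k * Complex.cos (k * (x + l))
          else -(ε : ℂ) * Complex.I * k * Complex.cos (k * (x - l))) := by
    intro k hk
    refine isEigenfun_ite hl (hasDerivAt_sin_mul_add_ofReal k l)
      (hasDerivAt_mul_cos_mul_add_ofReal k l) (fun x => ?_) (fun x => ?_) (by simpa) ?_ ?_
    · simpa only [mul_assoc, sub_eq_add_neg] using
        (hasDerivAt_sin_mul_add_ofReal k (-l) x).const_mul (-(ε : ℂ) * Complex.I)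
    · simpa only [mul_assoc, sub_eq_add_neg, mul_left_comm (-k ^ 2)] using
        (hasDerivAt_mul_cos_mul_add_ofReal k (-l) x).const_mul (-(ε : ℂ) * Complex.I)
    · rw [hexp]
      simp
    · rw [hexp']
      simp
      ring
  have affine : IsEigenfun l (ε * Real.pi / 2) 0
      (fun x : ℝ => if x < 0 then ((x : ℂ) + l) else -(ε : ℂ) * Complex.I * ((x : ℂ) - l))
      (fun x : ℝ => if x < 0 then 1 else -(ε : ℂ) * Complex.I) := by
    refine isEigenfun_ite hl (fun x => ?_) (fun x => ?_) (fun x => ?_) (fun x => ?_)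
      one_ne_zero ?_ ?_
    · simpa using hasDerivAt_mul_add_ofReal 1 l x
    · simpa using hasDerivAt_const x (1 : ℂ)
    · simpa only [sub_eq_add_neg] using
        hasDerivAt_mul_add_ofReal (-(ε : ℂ) * Complex.I) (-l) x
    · simpa using hasDerivAt_const x (-(ε : ℂ) * Complex.I)
    · rw [hexp]
      simp
    · rw [hexp']
      simp
  refine ⟨fun k hk => ⟨trig k hk, by simp [hl], by simp [hl.le]⟩,
    ⟨affine, by simp [hl], by simp [hl.le]⟩, fun lam => ?_⟩
  obtain ⟨k, rfl⟩ := IsAlgClosed.exists_pow_nat_eq lam two_pos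
  by_cases hk : k = 0
  · subst hk
    rw [zero_pow two_ne_zero]
    exact ⟨_, _, affine, by simp [hl], by simp [hl.le]⟩
  · exact ⟨_, _, trig k hk, by simp [hl], by simp [hl.le]⟩
end

section
/- Let l > 0, ε ∈ {1, −1}, L₀ ∈ ℝ with L₀ ≠ 0, and let U = (u_{jk}) be a 2×2 complex unitary matrix. Consider the boundary conditions at ±l given by (U − I)·(ψ(l), ψ(−l))ᵀ + i·L₀·(U + I)·(ψ'(l), −ψ'(−l))ᵀ = 0. Then: (a) if u₁₂ + u₂₁ + εi(u₁₁ − u₂₂) = 0, then for every λ ∈ ℂ there exists a (επ/2, λ)-eigenfunction on (−l, l) satisfying these conditions at ±l; (b) if u₁₂ + u₂₁ + εi(u₁₁ − u₂₂) ≠ 0, then for no λ ∈ ℂ does such an eigenfunction exist. In other words, the point spectrum of −d²/dx² on (−l,l) with the point interaction of parameter φ = επ/2 at the origin and self-adjoint (symmetric) boundary conditions at ±l is either all of ℂ or empty, the former occurring exactly when u₁₂ + u₂₁ + εi(u₁₁ − u₂₂) = 0. -/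
open MeasureTheory Filter Topology

/-- The general self-adjoint (symmetric) boundary conditions at `±l` parametrized by a
unitary matrix `U` and a real constant `L₀`:
`(U - I)(ψ(l), ψ(-l))ᵀ + i L₀ (U + I)(ψ'(l), -ψ'(-l))ᵀ = 0`. -/
def SymBC (l L₀ : ℝ) (U : Matrix (Fin 2) (Fin 2) ℂ) (ψ dψ : ℝ → ℂ) : Prop :=
  (U - 1).mulVec ![ψ l, ψ (-l)] +
    (Complex.I * (L₀ : ℂ)) • (U + 1).mulVec ![dψ l, -dψ (-l)] = 0

/-- The equation `-f'' = lam f` has a global solution with prescribed Cauchy data. -/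
theorem exists_global_solution (lam : ℂ) (a : ℝ) (p q : ℂ) :
    ∃ F dF : ℝ → ℂ, (∀ x, HasDerivAt F (dF x) x) ∧ (∀ x, HasDerivAt dF (-lam * F x) x) ∧
      F a = p ∧ dF a = q := by
  obtain ⟨k, rfl⟩ := IsAlgClosed.exists_pow_nat_eq lam two_pos
  by_cases hk : k = 0
  · subst hk
    refine ⟨fun x => p + q * ((x : ℂ) - a), fun _ => q, fun x => ?_, fun x => ?_, by simp, rfl⟩
    · have h := (((hasDerivAt_id x).ofReal_comp.sub_const (a : ℂ)).const_mul q).const_add p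
      simpa using h
    · simpa using hasDerivAt_const x q
  · have hlin : ∀ x : ℝ, HasDerivAt (fun y : ℝ => k * ((y : ℂ) - a)) k x := fun x => by
      simpa using ((hasDerivAt_id x).ofReal_comp.sub_const (a : ℂ)).const_mul k
    have hcos : ∀ x : ℝ, HasDerivAt (fun y : ℝ => Complex.cos (k * ((y : ℂ) - a)))
        (-Complex.sin (k * ((x : ℂ) - a)) * k) x := fun x =>
      (Complex.hasDerivAt_cos _).comp x (hlin x)
    have hsin : ∀ x : ℝ, HasDerivAt (fun y : ℝ => Complex.sin (k * ((y : ℂ) - a)))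
        (Complex.cos (k * ((x : ℂ) - a)) * k) x := fun x =>
      (Complex.hasDerivAt_sin _).comp x (hlin x)
    refine ⟨fun x => p * Complex.cos (k * ((x : ℂ) - a)) + q / k * Complex.sin (k * ((x : ℂ) - a)),
      fun x => -(p * k) * Complex.sin (k * ((x : ℂ) - a)) + q * Complex.cos (k * ((x : ℂ) - a)),
      fun x => ?_, fun x => ?_, by simp, by simp⟩
    · refine (((hcos x).const_mul p).add ((hsin x).const_mul (q / k))).congr_deriv ?_
      field_simp
    · refine (((hsin x).const_mul (-(p * k))).add ((hcos x).const_mul q)).congr_deriv ?_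
      field_simp
      ring

/-- The Wronskian of two solutions of `-f'' = lam f` on a convex set is constant. -/
theorem wronskian_eq {lam : ℂ} {s : Set ℝ} (hs : Convex ℝ s) {f df F dF : ℝ → ℂ}
    (hf : ∀ x ∈ s, HasDerivWithinAt f (df x) s x)
    (hdf : ∀ x ∈ s, HasDerivWithinAt df (-lam * f x) s x)
    (hF : ∀ x, HasDerivAt F (dF x) x) (hdF : ∀ x, HasDerivAt dF (-lam * F x) x)
    {x y : ℝ} (hx : x ∈ s) (hy : y ∈ s) :
    f x * dF x - df x * F x = f y * dF y - df y * F y := by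
  have hW : ∀ z ∈ s, HasDerivWithinAt (fun z => f z * dF z - df z * F z) 0 s z := fun z hz => by
    refine (((hf z hz).mul (hdF z).hasDerivWithinAt).sub
      ((hdf z hz).mul (hF z).hasDerivWithinAt)).congr_deriv ?_
    ring
  have h := hs.norm_image_sub_le_of_norm_hasDerivWithin_le (C := 0) hW (by simp) hy hx
  simpa [sub_eq_zero] using h

/-- A solution of `-f'' = lam f` whose Cauchy data tend to zero at a point of the closure of
its domain vanishes identically. -/
theorem solution_eq_zero {lam : ℂ} {s : Set ℝ} (hs : Convex ℝ s) {f df : ℝ → ℂ}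
    (hf : ∀ x ∈ s, HasDerivWithinAt f (df x) s x)
    (hdf : ∀ x ∈ s, HasDerivWithinAt df (-lam * f x) s x)
    {a : ℝ} {m : Filter ℝ} [m.NeBot] (hma : m ≤ 𝓝 a) (hms : ∀ᶠ y in m, y ∈ s)
    (h0 : Tendsto f m (𝓝 0)) (h1 : Tendsto df m (𝓝 0)) {x : ℝ} (hx : x ∈ s) : f x = 0 := by
  obtain ⟨F, dF, hF, hdF, hFx, hdFx⟩ := exists_global_solution lam x 0 1
  have hlim : Tendsto (fun y => f y * dF y - df y * F y) m (𝓝 (0 * dF a - 0 * F a)) :=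
    (h0.mul ((hdF a).continuousAt.tendsto.mono_left hma)).sub
      (h1.mul ((hF a).continuousAt.tendsto.mono_left hma))
  have hconst : Tendsto (fun y => f y * dF y - df y * F y) m (𝓝 (f x * dF x - df x * F x)) :=
    tendsto_const_nhds.congr' (hms.mono fun y hy => wronskian_eq hs hf hdf hF hdF hx hy)
  simpa [hFx, hdFx] using tendsto_nhds_unique hconst hlim

/-- The reflection of a function differentiable on `(0, l]` is differentiable on `[-l, 0)`. -/
theorem hasDerivWithinAt_comp_neg_Ico {l : ℝ} {f : ℝ → ℂ} {f' : ℂ} {x : ℝ}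
    (h : HasDerivWithinAt f f' (Set.Ioc 0 l) (-x)) :
    HasDerivWithinAt (fun y => f (-y)) (-f') (Set.Ico (-l) 0) x := by
  have hmaps : Set.MapsTo (fun y : ℝ => -y) (Set.Ico (-l) 0) (Set.Ioc 0 l) := fun y hy =>
    ⟨by linarith [hy.2], by linarith [hy.1]⟩
  refine (HasDerivWithinAt.scomp x h (hasDerivAt_neg x).hasDerivWithinAt hmaps).congr_deriv ?_
  simp

theorem exp_I_mul_half_pi {ε : ℝ} (hε : ε = 1 ∨ ε = -1) :
    Complex.exp (Complex.I * ((ε * Real.pi / 2 : ℝ) : ℂ)) = ε * Complex.I := by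
  rcases hε with rfl | rfl
  · rw [show Complex.I * ((1 * Real.pi / 2 : ℝ) : ℂ) = Real.pi / 2 * Complex.I by
      push_cast; ring, Complex.exp_pi_div_two_mul_I]
    simp
  · rw [show Complex.I * ((-1 * Real.pi / 2 : ℝ) : ℂ) = -(Real.pi / 2 * Complex.I) by
      push_cast; ring, Complex.exp_neg, Complex.exp_pi_div_two_mul_I]
    simp

theorem exp_neg_I_mul_half_pi {ε : ℝ} (hε : ε = 1 ∨ ε = -1) :
    Complex.exp (-(Complex.I * ((ε * Real.pi / 2 : ℝ) : ℂ))) = -(ε * Complex.I) := by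
  rw [Complex.exp_neg, exp_I_mul_half_pi hε]
  rcases hε with rfl | rfl <;> simp

/-- The boundary conditions at `±l`, written out in coordinates. -/
theorem symBC_iff (l L₀ : ℝ) (U : Matrix (Fin 2) (Fin 2) ℂ) (ψ dψ : ℝ → ℂ) :
    SymBC l L₀ U ψ dψ ↔
      ((U 0 0 - 1) * ψ l + U 0 1 * ψ (-l)
        + Complex.I * L₀ * ((U 0 0 + 1) * dψ l - U 0 1 * dψ (-l)) = 0) ∧
      (U 1 0 * ψ l + (U 1 1 - 1) * ψ (-l)
        + Complex.I * L₀ * (U 1 0 * dψ l - (U 1 1 + 1) * dψ (-l)) = 0) := by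
  unfold SymBC
  simp [funext_iff, Fin.forall_fin_two, sub_eq_add_neg]

/-- An eigenfunction for `e^{iφ} = w`, `w² = -1`, is determined on the right half by its
values on the left half, and has nonzero Cauchy data at `-l`. -/
theorem IsEigenfun.endpoint_relations {l φ : ℝ} (hl : 0 < l) {lam w : ℂ} {ψ dψ : ℝ → ℂ}
    (h : IsEigenfun l φ lam ψ dψ) (hw : Complex.exp (Complex.I * φ) = w)
    (hw' : Complex.exp (-(Complex.I * φ)) = -w) :
    ψ l = w * ψ (-l) ∧ dψ l = -w * dψ (-l) ∧ (ψ (-l) ≠ 0 ∨ dψ (-l) ≠ 0) := by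
  obtain ⟨⟨x, ⟨hxl, hx0⟩, hx⟩, hm, hdm, hp, hdp, p0, m0, dp0, dm0, tp, tm, tdp, tdm, e, de⟩ := h
  rw [hw] at e
  rw [hw'] at de
  have hneg : ∀ y ∈ Set.Ico (-l) (0 : ℝ), -y ∈ Set.Ioc 0 l := fun y hy =>
    ⟨by linarith [hy.2], by linarith [hy.1]⟩
  have hml : -l ∈ Set.Ico (-l) (0 : ℝ) := ⟨le_rfl, by linarith⟩
  have hd1 : ∀ y ∈ Set.Ico (-l) (0 : ℝ), HasDerivWithinAt (fun y => ψ (-y) - w * ψ y)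
      (-dψ (-y) - w * dψ y) (Set.Ico (-l) 0) y := fun y hy =>
    (hasDerivWithinAt_comp_neg_Ico (hp _ (hneg y hy))).sub ((hm y hy).const_mul w)
  have hd2 : ∀ y ∈ Set.Ico (-l) (0 : ℝ), HasDerivWithinAt (fun y => -dψ (-y) - w * dψ y)
      (-lam * (ψ (-y) - w * ψ y)) (Set.Ico (-l) 0) y := fun y hy => by
    refine ((hasDerivWithinAt_comp_neg_Ico (hdp _ (hneg y hy))).neg.sub
      ((hdm y hy).const_mul w)).congr_deriv ?_
    ring
  have hrefl : Tendsto (fun y : ℝ => -y) (𝓝[<] 0) (𝓝[>] 0) := by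
    simpa using tendsto_neg_nhdsLT (a := (0 : ℝ))
  have hsymm : ∀ y ∈ Set.Ico (-l) (0 : ℝ), ψ (-y) - w * ψ y = 0 := fun y hy => by
    refine solution_eq_zero (convex_Ico _ _) hd1 hd2 (m := 𝓝[<] 0) nhdsWithin_le_nhds
      (Ico_mem_nhdsLT (by linarith)) ?_ ?_ hy
    · simpa [e] using (tp.comp hrefl).sub (tm.const_mul w)
    · simpa [de] using (tdp.comp hrefl).neg.sub (tdm.const_mul w)
  have hdsymm : -dψ l - w * dψ (-l) = 0 := by
    have h0 : HasDerivWithinAt (fun y => ψ (-y) - w * ψ y) 0 (Set.Ico (-l) 0) (-l) :=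
      (hasDerivWithinAt_const (-l) _ (0 : ℂ)).congr hsymm (hsymm _ hml)
    simpa using (uniqueDiffOn_Ico (-l) 0 _ hml).eq_deriv _ (hd1 _ hml) h0
  refine ⟨by simpa [sub_eq_zero] using hsymm _ hml, by linear_combination -hdsymm, ?_⟩
  by_contra! hzero
  have hleft : ∀ y ∈ Set.Ico (-l) (0 : ℝ), ψ y = 0 := fun y hy =>
    solution_eq_zero (convex_Ico _ _) hm hdm (m := pure (-l)) (pure_le_nhds _)
      (by simpa using hl) (by simpa [hzero.1] using tendsto_pure_nhds ψ (-l))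
      (by simpa [hzero.2] using tendsto_pure_nhds dψ (-l)) hy
  rcases lt_or_gt_of_ne hx0 with hneg' | hpos
  · exact hx (hleft x ⟨hxl.1, hneg'⟩)
  · have hmem : -x ∈ Set.Ico (-l) (0 : ℝ) := ⟨by linarith [hxl.2], by linarith⟩
    exact hx (by simpa [hleft _ hmem] using hsymm _ hmem)

/-- If `e^{iφ} = w` and `e^{-iφ} = -w`, any nonzero Cauchy data at `-l` extend to an eigenfunction,
for every `lam`. -/
theorem exists_isEigenfun {l φ : ℝ} (hl : 0 < l) (lam : ℂ) {w : ℂ}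
    (hw : Complex.exp (Complex.I * φ) = w) (hw' : Complex.exp (-(Complex.I * φ)) = -w)
    {p q : ℂ} (hpq : p ≠ 0 ∨ q ≠ 0) :
    ∃ ψ dψ : ℝ → ℂ, IsEigenfun l φ lam ψ dψ ∧
      ψ (-l) = p ∧ dψ (-l) = q ∧ ψ l = w * p ∧ dψ l = -w * q := by
  obtain ⟨F, dF, hF, hdF, hFp, hdFq⟩ := exists_global_solution lam (-l) p q
  have hR : ∀ x, HasDerivAt (fun y => w * F (-y)) (-w * dF (-x)) x := fun x => by
    refine ((HasDerivAt.scomp x (hF (-x)) (hasDerivAt_neg x)).const_mul w).congr_deriv ?_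
    simp
  have hdR : ∀ x, HasDerivAt (fun y => -w * dF (-y)) (-lam * (w * F (-x))) x := fun x => by
    refine ((HasDerivAt.scomp x (hdF (-x)) (hasDerivAt_neg x)).const_mul (-w)).congr_deriv ?_
    simp
    ring
  let ψ : ℝ → ℂ := fun x => if x < 0 then F x else w * F (-x)
  let dψ : ℝ → ℂ := fun x => if x < 0 then dF x else -w * dF (-x)
  have hψn : ∀ x, x < 0 → ψ x = F x := fun x hx => if_pos hx
  have hdψn : ∀ x, x < 0 → dψ x = dF x := fun x hx => if_pos hx
  have hψp : ∀ x, 0 < x → ψ x = w * F (-x) := fun x hx => if_neg hx.not_gt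
  have hdψp : ∀ x, 0 < x → dψ x = -w * dF (-x) := fun x hx => if_neg hx.not_gt
  have hml : -l ∈ Set.Ico (-l) (0 : ℝ) := ⟨le_rfl, by linarith⟩
  have hψm : ∀ x ∈ Set.Ico (-l) (0 : ℝ), HasDerivWithinAt ψ (dψ x) (Set.Ico (-l) 0) x :=
    fun x hx => by
      rw [hdψn x hx.2]
      exact (hF x).hasDerivWithinAt.congr (fun y hy => hψn y hy.2) (hψn x hx.2)
  refine ⟨ψ, dψ, ⟨?_, hψm, fun x hx => ?_, fun x hx => ?_, fun x hx => ?_,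
    w * F 0, F 0, -w * dF 0, dF 0, ?_, ?_, ?_, ?_, by rw [hw], by rw [hw']⟩,
    by rw [hψn _ hml.2, hFp], by rw [hdψn _ hml.2, hdFq], by rw [hψp _ hl, hFp],
    by rw [hdψp _ hl, hdFq]⟩
  · by_contra! hzero
    have hz : ∀ x ∈ Set.Ico (-l) (0 : ℝ), ψ x = 0 := fun x hx =>
      hzero x ⟨⟨hx.1, by linarith [hx.2]⟩, hx.2.ne⟩
    have hd := (uniqueDiffOn_Ico (-l) 0 _ hml).eq_deriv _ (hψm _ hml)
      ((hasDerivWithinAt_const (-l) _ (0 : ℂ)).congr hz (hz _ hml))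
    have hv := hz _ hml
    rw [hdψn _ hml.2, hdFq] at hd
    rw [hψn _ hml.2, hFp] at hv
    tauto
  · rw [hψn x hx.2]
    exact (hdF x).hasDerivWithinAt.congr (fun y hy => hdψn y hy.2) (hdψn x hx.2)
  · rw [hdψp x hx.1]
    exact (hR x).hasDerivWithinAt.congr (fun y hy => hψp y hy.1) (hψp x hx.1)
  · rw [hψp x hx.1]
    exact (hdR x).hasDerivWithinAt.congr (fun y hy => hdψp y hy.1) (hdψp x hx.1)
  · have h := (hR 0).continuousAt.tendsto.mono_left (nhdsWithin_le_nhds (s := Set.Ioi 0))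
    rw [neg_zero] at h
    exact h.congr' (eventually_nhdsWithin_of_forall fun y hy => (hψp y hy).symm)
  · exact ((hF 0).continuousAt.tendsto.mono_left nhdsWithin_le_nhds).congr'
      (eventually_nhdsWithin_of_forall fun y hy => (hψn y hy).symm)
  · have h := (hdR 0).continuousAt.tendsto.mono_left (nhdsWithin_le_nhds (s := Set.Ioi 0))
    rw [neg_zero] at h
    exact h.congr' (eventually_nhdsWithin_of_forall fun y hy => (hdψp y hy).symm)
  · exact ((hdF 0).continuousAt.tendsto.mono_left nhdsWithin_le_nhds).congr'
      (eventually_nhdsWithin_of_forall fun y hy => (hdψn y hy).symm)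

/-- With the point interaction `φ = επ/2` at the origin and self-adjoint
boundary conditions at `±l` given by a unitary `U` and `L₀ ≠ 0`:
(a) if `u₁₂ + u₂₁ + εi(u₁₁ - u₂₂) = 0` then every `λ ∈ ℂ` admits a `(επ/2, λ)`-eigenfunction;
(b) otherwise no `λ ∈ ℂ` does. Thus the point spectrum is either all of `ℂ` or empty. -/
theorem surprising_spectra_stmt15
    (l : ℝ) (hl : 0 < l) (ε : ℝ) (hε : ε = 1 ∨ ε = -1)
    (L₀ : ℝ) (hL₀ : L₀ ≠ 0)
    (U : Matrix (Fin 2) (Fin 2) ℂ) (hU : U ∈ Matrix.unitaryGroup (Fin 2) ℂ) :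
    -- (a)
    (U 0 1 + U 1 0 + (ε : ℂ) * Complex.I * (U 0 0 - U 1 1) = 0 →
      ∀ lam : ℂ, ∃ ψ dψ : ℝ → ℂ,
        IsEigenfun l (ε * Real.pi / 2) lam ψ dψ ∧ SymBC l L₀ U ψ dψ) ∧
    -- (b)
    (U 0 1 + U 1 0 + (ε : ℂ) * Complex.I * (U 0 0 - U 1 1) ≠ 0 →
      ∀ lam : ℂ, ¬ ∃ ψ dψ : ℝ → ℂ,
        IsEigenfun l (ε * Real.pi / 2) lam ψ dψ ∧ SymBC l L₀ U ψ dψ) := by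
  have hw := exp_I_mul_half_pi hε
  have hw' := exp_neg_I_mul_half_pi hε
  have hsq : ((ε : ℂ) * Complex.I) ^ 2 = -1 := by
    rcases hε with rfl | rfl <;> simp
  have hL : Complex.I * (L₀ : ℂ) ≠ 0 := by simpa using hL₀
  set w : ℂ := (ε : ℂ) * Complex.I
  refine ⟨fun h lam => ?_, ?_⟩
  · -- `(w, 1)` is an eigenvector of `U` with eigenvalue `μ`
    set μ : ℂ := U 1 0 * w + U 1 1 with hμ
    have hpq : Complex.I * L₀ * (μ + 1) ≠ 0 ∨ μ - 1 ≠ 0 := by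
      by_contra! hc
      have h1 := (mul_eq_zero.mp hc.1).resolve_left hL
      have h2 : (2 : ℂ) = 0 := by linear_combination h1 - hc.2
      norm_num at h2
    obtain ⟨ψ, dψ, he, e1, e2, e3, e4⟩ := exists_isEigenfun hl lam hw hw' hpq
    refine ⟨ψ, dψ, he, ?_⟩
    have hrow : U 0 0 * w + U 0 1 = μ * w := by
      rw [hμ]
      linear_combination h - U 1 0 * hsq
    rw [symBC_iff, e1, e2, e3, e4]
    constructor
    · linear_combination 2 * Complex.I * L₀ * hrow
    · linear_combination -2 * Complex.I * L₀ * hμ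
  · rintro h lam ⟨ψ, dψ, he, hbc⟩
    obtain ⟨e1, e2, e3⟩ := he.endpoint_relations hl hw hw'
    rw [symBC_iff, e1, e2] at hbc
    obtain ⟨b1, b2⟩ := hbc
    have hprod : (U 0 1 + U 1 0 + w * (U 0 0 - U 1 1)) *
        (ψ (-l) - Complex.I * L₀ * dψ (-l)) = 0 := by
      linear_combination b1 - w * b2 +
        U 1 0 * (ψ (-l) - Complex.I * L₀ * dψ (-l)) * hsq
    have hplus := (mul_eq_zero.mp hprod).resolve_left h
    have hminus : ψ (-l) + Complex.I * L₀ * dψ (-l) = 0 := by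
      linear_combination (U 1 0 * w + U 1 1) * hplus - b2
    have hψ : ψ (-l) = 0 := by linear_combination (hplus + hminus) / 2
    have hdψ : Complex.I * L₀ * dψ (-l) = 0 := by linear_combination (hminus - hplus) / 2
    exact e3.elim (· hψ) (· ((mul_eq_zero.mp hdψ).resolve_left hL))
end

section
/- Let l > 0, φ ∈ (−π, π], L₀ ∈ ℝ, and let U = (u_{jk}) be a 2×2 complex unitary matrix; set P₁(U) = 1 − u₁₁ − u₁₂u₂₁ − u₂₂ + u₁₁u₂₂, P₂(U) = 1 + u₁₂u₂₁ − u₁₁u₂₂, P₃(U) = 1 + u₁₁ − u₁₂u₂₁ + u₂₂ + u₁₁u₂₂. For k ∈ ℂ with k ≠ 0, there exists a (φ, k²)-eigenfunction on (−l, l) satisfying the boundary conditions (U − I)·(ψ(l), ψ(−l))ᵀ + i·L₀·(U + I)·(ψ'(l), −ψ'(−l))ᵀ = 0 at ±l if and only if cos φ·[ (P₁(U) + k²L₀²·P₃(U))·sin(2kl) − 2ikL₀·P₂(U)·cos(2kl) ] + 2ikL₀·[ u₁₂ + u₂₁ + i(u₁₁ − u₂₂)·sin φ ] = 0. -/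
open MeasureTheory Filter Topology

/-- The solution of `-f'' = k ^ 2 f` with `f 0 = a` and `f' 0 = b`. -/
noncomputable def helmholtzSol (k a b : ℂ) (x : ℝ) : ℂ :=
  a * Complex.cos (k * x) + b / k * Complex.sin (k * x)

/-- The derivative of `helmholtzSol`. -/
noncomputable def helmholtzSolDeriv (k a b : ℂ) (x : ℝ) : ℂ :=
  -(a * k * Complex.sin (k * x)) + b * Complex.cos (k * x)

lemma hasDerivAt_cos_mul_ofReal (k : ℂ) (x : ℝ) :
    HasDerivAt (fun y : ℝ => Complex.cos (k * y)) (-Complex.sin (k * x) * k) x := by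
  have h : HasDerivAt (fun z : ℂ => Complex.cos (k * z)) (-Complex.sin (k * x) * k) (x : ℂ) := by
    simpa using ((hasDerivAt_id (x : ℂ)).const_mul k).ccos
  exact h.comp_ofReal

lemma hasDerivAt_sin_mul_ofReal (k : ℂ) (x : ℝ) :
    HasDerivAt (fun y : ℝ => Complex.sin (k * y)) (Complex.cos (k * x) * k) x := by
  have h : HasDerivAt (fun z : ℂ => Complex.sin (k * z)) (Complex.cos (k * x) * k) (x : ℂ) := by
    simpa using ((hasDerivAt_id (x : ℂ)).const_mul k).csin
  exact h.comp_ofReal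

lemma hasDerivAt_helmholtzSol {k : ℂ} (hk : k ≠ 0) (a b : ℂ) (x : ℝ) :
    HasDerivAt (helmholtzSol k a b) (helmholtzSolDeriv k a b x) x := by
  refine (((hasDerivAt_cos_mul_ofReal k x).const_mul a).add
    ((hasDerivAt_sin_mul_ofReal k x).const_mul (b / k))).congr_deriv ?_
  simp only [helmholtzSolDeriv]
  field_simp

lemma hasDerivAt_helmholtzSolDeriv {k : ℂ} (hk : k ≠ 0) (a b : ℂ) (x : ℝ) :
    HasDerivAt (helmholtzSolDeriv k a b) (-k ^ 2 * helmholtzSol k a b x) x := by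
  refine (((hasDerivAt_sin_mul_ofReal k x).const_mul (a * k)).neg.add
    ((hasDerivAt_cos_mul_ofReal k x).const_mul b)).congr_deriv ?_
  simp only [helmholtzSol]
  field_simp
  ring

lemma tendsto_helmholtzSol {k : ℂ} (hk : k ≠ 0) (a b : ℂ) (s : Set ℝ) :
    Tendsto (helmholtzSol k a b) (𝓝[s] 0) (𝓝 a) := by
  have h := (hasDerivAt_helmholtzSol hk a b 0).continuousAt.tendsto.mono_left
    (nhdsWithin_le_nhds (s := s))
  simpa [helmholtzSol] using h

lemma tendsto_helmholtzSolDeriv {k : ℂ} (hk : k ≠ 0) (a b : ℂ) (s : Set ℝ) :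
    Tendsto (helmholtzSolDeriv k a b) (𝓝[s] 0) (𝓝 b) := by
  have h := (hasDerivAt_helmholtzSolDeriv hk a b 0).continuousAt.tendsto.mono_left
    (nhdsWithin_le_nhds (s := s))
  simpa [helmholtzSolDeriv] using h

lemma eq_of_hasDerivWithinAt_zero {s : Set ℝ} (hs : Convex ℝ s) {f : ℝ → ℂ}
    (hf : ∀ x ∈ s, HasDerivWithinAt f 0 s x) {x y : ℝ} (hx : x ∈ s) (hy : y ∈ s) :
    f x = f y := by
  have h := hs.norm_image_sub_le_of_norm_hasDerivWithin_le (C := 0) hf (by simp) hy hx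
  simpa [sub_eq_zero] using h

/-- Solutions of `-f'' = k ^ 2 f` on a convex set are combinations of `cos` and `sin`. -/
lemma exists_eq_helmholtzSol {k : ℂ} (hk : k ≠ 0) {s : Set ℝ} (hs : Convex ℝ s) {f df : ℝ → ℂ}
    (hf : ∀ x ∈ s, HasDerivWithinAt f (df x) s x)
    (hdf : ∀ x ∈ s, HasDerivWithinAt df (-k ^ 2 * f x) s x) :
    ∃ a b : ℂ, ∀ x ∈ s, f x = helmholtzSol k a b x ∧ df x = helmholtzSolDeriv k a b x := by
  rcases s.eq_empty_or_nonempty with rfl | ⟨x₀, hx₀⟩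
  · simp
  have hA : ∀ x ∈ s, HasDerivWithinAt
      (fun y : ℝ => f y * Complex.cos (k * y) - df y * (Complex.sin (k * y) / k)) 0 s x := by
    intro x hx
    refine (((hf x hx).mul (hasDerivAt_cos_mul_ofReal k x).hasDerivWithinAt).sub
      ((hdf x hx).mul
        ((hasDerivAt_sin_mul_ofReal k x).div_const k).hasDerivWithinAt)).congr_deriv ?_
    field_simp
    ring
  have hB : ∀ x ∈ s, HasDerivWithinAt
      (fun y : ℝ => f y * (k * Complex.sin (k * y)) + df y * Complex.cos (k * y)) 0 s x := by
    intro x hx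
    refine (((hf x hx).mul
      ((hasDerivAt_sin_mul_ofReal k x).const_mul k).hasDerivWithinAt).add
      ((hdf x hx).mul (hasDerivAt_cos_mul_ofReal k x).hasDerivWithinAt)).congr_deriv ?_
    ring
  refine ⟨f x₀ * Complex.cos (k * x₀) - df x₀ * (Complex.sin (k * x₀) / k),
    f x₀ * (k * Complex.sin (k * x₀)) + df x₀ * Complex.cos (k * x₀), fun x hx => ?_⟩
  rw [← eq_of_hasDerivWithinAt_zero hs hA hx hx₀, ← eq_of_hasDerivWithinAt_zero hs hB hx hx₀]
  have hcs := Complex.sin_sq_add_cos_sq (k * x)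
  simp only [helmholtzSol, helmholtzSolDeriv]
  constructor
  · field_simp
    linear_combination (-(k * f x)) * hcs
  · field_simp
    linear_combination (-df x) * hcs

lemma exists_helmholtzSol_ne_zero {k : ℂ} (hk : k ≠ 0) {a b : ℂ} (hab : a ≠ 0 ∨ b ≠ 0)
    {s : Set ℝ} (hs : IsOpen s) (hne : s.Nonempty) : ∃ x ∈ s, helmholtzSol k a b x ≠ 0 := by
  by_contra! h
  obtain ⟨x, hx⟩ := hne
  have h0 : HasDerivAt (helmholtzSol k a b) 0 x :=
    (hasDerivAt_const x (0 : ℂ)).congr_of_eventuallyEq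
      (Filter.eventually_of_mem (hs.mem_nhds hx) h)
  have h1 := (hasDerivAt_helmholtzSol hk a b x).unique h0
  have h2 := h x hx
  have hcs := Complex.sin_sq_add_cos_sq (k * x)
  simp only [helmholtzSol, helmholtzSolDeriv] at h1 h2
  field_simp at h2
  have ha : k * a = 0 := by
    linear_combination Complex.cos (k * x) * h2 - Complex.sin (k * x) * h1 - k * a * hcs
  have hb : b = 0 := by
    linear_combination Complex.sin (k * x) * h2 + Complex.cos (k * x) * h1 - b * hcs
  simp_all

/-- An eigenfunction is, up to its value at `0`, given by two nonzero solutions matched at `0`. -/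
lemma IsEigenfun.exists_eq_helmholtzSol {l φr : ℝ} {k : ℂ} (hl : 0 < l) (hk : k ≠ 0)
    {ψ dψ : ℝ → ℂ} (h : IsEigenfun l φr (k ^ 2) ψ dψ) :
    ∃ a b : ℂ, (a ≠ 0 ∨ b ≠ 0) ∧
      (∀ x ∈ Set.Ico (-l) 0, ψ x = helmholtzSol k a b x ∧ dψ x = helmholtzSolDeriv k a b x) ∧
      ∀ x ∈ Set.Ioc 0 l,
        ψ x = helmholtzSol k (Complex.exp (Complex.I * φr) * a)
          (Complex.exp (-(Complex.I * φr)) * b) x ∧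
        dψ x = helmholtzSolDeriv k (Complex.exp (Complex.I * φr) * a)
          (Complex.exp (-(Complex.I * φr)) * b) x := by
  obtain ⟨⟨x, ⟨hx, hx0⟩, hψx⟩, hm, hdm, hp, hdp, ψ0p, ψ0m, dψ0p, dψ0m, tp, tm, tdp, tdm, rfl, rfl⟩ :=
    h
  obtain ⟨a, b, hab⟩ := _root_.exists_eq_helmholtzSol hk (convex_Ico _ _) hm hdm
  obtain ⟨A, B, hAB⟩ := _root_.exists_eq_helmholtzSol hk (convex_Ioc _ _) hp hdp
  have em : ∀ᶠ y in 𝓝[<] (0 : ℝ), y ∈ Set.Ico (-l) 0 :=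
    mem_of_superset (Ioo_mem_nhdsLT (by linarith : -l < 0)) Set.Ioo_subset_Ico_self
  have ep : ∀ᶠ y in 𝓝[>] (0 : ℝ), y ∈ Set.Ioc 0 l :=
    mem_of_superset (Ioo_mem_nhdsGT hl) Set.Ioo_subset_Ioc_self
  have ha := tendsto_nhds_unique
    (tm.congr' (em.mono fun y hy => (hab y hy).1)) (tendsto_helmholtzSol hk a b _)
  have hb := tendsto_nhds_unique
    (tdm.congr' (em.mono fun y hy => (hab y hy).2)) (tendsto_helmholtzSolDeriv hk a b _)
  have hA := tendsto_nhds_unique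
    (tp.congr' (ep.mono fun y hy => (hAB y hy).1)) (tendsto_helmholtzSol hk A B _)
  have hB := tendsto_nhds_unique
    (tdp.congr' (ep.mono fun y hy => (hAB y hy).2)) (tendsto_helmholtzSolDeriv hk A B _)
  subst ha hb hA hB
  refine ⟨_, _, ?_, hab, hAB⟩
  by_contra! h0
  rcases lt_or_gt_of_ne hx0 with hlt | hgt
  · exact hψx (by simp [(hab x ⟨hx.1, hlt⟩).1, helmholtzSol, h0])
  · exact hψx (by simp [(hAB x ⟨hgt, hx.2⟩).1, helmholtzSol, h0])

/-- Matched solutions on the two half-intervals glue to an eigenfunction. -/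
lemma isEigenfun_ite_helmholtzSol {l φr : ℝ} {k a b : ℂ} (hl : 0 < l) (hk : k ≠ 0)
    (hab : a ≠ 0 ∨ b ≠ 0) :
    IsEigenfun l φr (k ^ 2)
      (fun x => if x < 0 then helmholtzSol k a b x else
        helmholtzSol k (Complex.exp (Complex.I * φr) * a) (Complex.exp (-(Complex.I * φr)) * b) x)
      (fun x => if x < 0 then helmholtzSolDeriv k a b x else
        helmholtzSolDeriv k (Complex.exp (Complex.I * φr) * a)
          (Complex.exp (-(Complex.I * φr)) * b) x) := by
  obtain ⟨x, hx, hx0⟩ := exists_helmholtzSol_ne_zero hk hab (isOpen_Ioo (a := -l) (b := 0))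
    (Set.nonempty_Ioo.2 (by linarith))
  refine ⟨⟨x, ⟨⟨hx.1.le, hx.2.le.trans hl.le⟩, hx.2.ne⟩, by simpa [hx.2] using hx0⟩,
    fun y hy => ?_, fun y hy => ?_, fun y hy => ?_, fun y hy => ?_,
    _, a, _, b, ?_, ?_, ?_, ?_, rfl, rfl⟩
  · simp only [if_pos hy.2]
    exact (hasDerivAt_helmholtzSol hk a b y).hasDerivWithinAt.congr_of_mem
      (fun z hz => if_pos hz.2) hy
  · simp only [if_pos hy.2]
    exact (hasDerivAt_helmholtzSolDeriv hk a b y).hasDerivWithinAt.congr_of_mem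
      (fun z hz => if_pos hz.2) hy
  · simp only [if_neg hy.1.not_gt]
    exact (hasDerivAt_helmholtzSol hk _ _ y).hasDerivWithinAt.congr_of_mem
      (fun z hz => if_neg hz.1.not_gt) hy
  · simp only [if_neg hy.1.not_gt]
    exact (hasDerivAt_helmholtzSolDeriv hk _ _ y).hasDerivWithinAt.congr_of_mem
      (fun z hz => if_neg hz.1.not_gt) hy
  · exact (tendsto_helmholtzSol hk _ _ _).congr'
      (eventually_mem_nhdsWithin.mono fun z hz => (if_neg (Set.mem_Ioi.1 hz).not_gt).symm)
  · exact (tendsto_helmholtzSol hk _ _ _).congr'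
      (eventually_mem_nhdsWithin.mono fun z hz => (if_pos (Set.mem_Iio.1 hz)).symm)
  · exact (tendsto_helmholtzSolDeriv hk _ _ _).congr'
      (eventually_mem_nhdsWithin.mono fun z hz => (if_neg (Set.mem_Ioi.1 hz).not_gt).symm)
  · exact (tendsto_helmholtzSolDeriv hk _ _ _).congr'
      (eventually_mem_nhdsWithin.mono fun z hz => (if_pos (Set.mem_Iio.1 hz)).symm)

/-- The matrix of the boundary conditions `(U, L₀)` in terms of the left limits at `0`. -/
noncomputable def secularMatrix (l φr L₀ : ℝ) (U : Matrix (Fin 2) (Fin 2) ℂ) (k : ℂ) :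
    Matrix (Fin 2) (Fin 2) ℂ :=
  (U - 1) * !![Complex.exp (Complex.I * φr) * Complex.cos (k * l),
      Complex.exp (-(Complex.I * φr)) / k * Complex.sin (k * l);
      Complex.cos (k * l), -(Complex.sin (k * l) / k)] +
    (Complex.I * (L₀ : ℂ)) • ((U + 1) *
      !![-(Complex.exp (Complex.I * φr) * k * Complex.sin (k * l)),
        Complex.exp (-(Complex.I * φr)) * Complex.cos (k * l);
        -(k * Complex.sin (k * l)), -Complex.cos (k * l)])

lemma secularMatrix_mulVec (l φr L₀ : ℝ) (U : Matrix (Fin 2) (Fin 2) ℂ) (k a b : ℂ) :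
    (secularMatrix l φr L₀ U k).mulVec ![a, b] =
      (U - 1).mulVec ![helmholtzSol k (Complex.exp (Complex.I * φr) * a)
          (Complex.exp (-(Complex.I * φr)) * b) l, helmholtzSol k a b (-l)] +
        (Complex.I * (L₀ : ℂ)) • (U + 1).mulVec
          ![helmholtzSolDeriv k (Complex.exp (Complex.I * φr) * a)
            (Complex.exp (-(Complex.I * φr)) * b) l, -helmholtzSolDeriv k a b (-l)] := by
  rw [secularMatrix, Matrix.add_mulVec, Matrix.smul_mulVec, ← Matrix.mulVec_mulVec,
    ← Matrix.mulVec_mulVec]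
  congr 3
  · ext i
    fin_cases i <;> simp [helmholtzSol, Matrix.mulVec, dotProduct] <;> ring
  · ext i
    fin_cases i <;> simp [helmholtzSolDeriv, Matrix.mulVec, dotProduct] <;> ring

lemma neg_mul_det_secularMatrix (l φr L₀ : ℝ) (U : Matrix (Fin 2) (Fin 2) ℂ) {k : ℂ}
    (hk : k ≠ 0) :
    -k * (secularMatrix l φr L₀ U k).det =
      (Real.cos φr : ℂ) *
        (((1 - U 0 0 - U 0 1 * U 1 0 - U 1 1 + U 0 0 * U 1 1) +
            k ^ 2 * (L₀ : ℂ) ^ 2 * (1 + U 0 0 - U 0 1 * U 1 0 + U 1 1 + U 0 0 * U 1 1)) *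
              Complex.sin (2 * k * l) -
          2 * Complex.I * k * (L₀ : ℂ) * (1 + U 0 1 * U 1 0 - U 0 0 * U 1 1) *
            Complex.cos (2 * k * l)) +
      2 * Complex.I * k * (L₀ : ℂ) *
        (U 0 1 + U 1 0 + Complex.I * (U 0 0 - U 1 1) * (Real.sin φr : ℂ)) := by
  have he : Complex.exp (Complex.I * φr) = Complex.cos φr + Complex.sin φr * Complex.I := by
    rw [mul_comm, Complex.exp_mul_I]
  have he' : Complex.exp (-(Complex.I * φr)) = Complex.cos φr - Complex.sin φr * Complex.I := by
    rw [show -(Complex.I * (φr : ℂ)) = (-φr : ℂ) * Complex.I by ring, Complex.exp_mul_I]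
    simp [sub_eq_add_neg]
  have hcs := Complex.sin_sq_add_cos_sq (k * l)
  have hφ := Complex.sin_sq_add_cos_sq (φr : ℂ)
  have hI := Complex.I_sq
  rw [mul_assoc 2 k, Complex.sin_two_mul, Complex.cos_two_mul']
  push_cast
  simp only [secularMatrix, Matrix.det_fin_two, Matrix.add_apply, Matrix.smul_apply,
    Matrix.sub_apply, Matrix.mul_apply, Fin.sum_univ_two, Matrix.of_apply, Matrix.cons_val',
    Matrix.cons_val_zero, Matrix.cons_val_one, smul_eq_mul, he, he',
    Matrix.one_fin_two, Matrix.cons_val_fin_one]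
  generalize Complex.sin (k * l) = s at *
  generalize Complex.cos (k * l) = c at *
  generalize Complex.sin (φr : ℂ) = S at *
  generalize Complex.cos (φr : ℂ) = C at *
  generalize U 0 0 = p at *
  generalize U 0 1 = q at *
  generalize U 1 0 = r at *
  generalize U 1 1 = t at *
  generalize (L₀ : ℂ) = L at *
  generalize Complex.I = I at *
  field_simp
  grind

/-- the secular equation for the point interaction of parameter `φ` at the
origin with self-adjoint boundary conditions `(U, L₀)` at `±l`: for `k ≠ 0`, a
`(φ, k²)`-eigenfunction exists iff
`cos φ [(P₁ + k²L₀²P₃) sin 2kl - 2ikL₀P₂ cos 2kl] + 2ikL₀[u₁₂ + u₂₁ + i(u₁₁-u₂₂) sin φ] = 0`. -/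
theorem surprising_spectra_stmt16
    (l : ℝ) (hl : 0 < l) (φr : ℝ) (hφr : φr ∈ Set.Ioc (-Real.pi) Real.pi)
    (L₀ : ℝ) (U : Matrix (Fin 2) (Fin 2) ℂ) (hU : U ∈ Matrix.unitaryGroup (Fin 2) ℂ)
    (P₁ P₂ P₃ : ℂ)
    (hP₁ : P₁ = 1 - U 0 0 - U 0 1 * U 1 0 - U 1 1 + U 0 0 * U 1 1)
    (hP₂ : P₂ = 1 + U 0 1 * U 1 0 - U 0 0 * U 1 1)
    (hP₃ : P₃ = 1 + U 0 0 - U 0 1 * U 1 0 + U 1 1 + U 0 0 * U 1 1)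
    (k : ℂ) (hk : k ≠ 0) :
    (∃ ψ dψ : ℝ → ℂ, IsEigenfun l φr (k ^ 2) ψ dψ ∧ SymBC l L₀ U ψ dψ) ↔
    (Real.cos φr : ℂ) *
        ((P₁ + k ^ 2 * (L₀ : ℂ) ^ 2 * P₃) * Complex.sin (2 * k * l) -
          2 * Complex.I * k * (L₀ : ℂ) * P₂ * Complex.cos (2 * k * l)) +
      2 * Complex.I * k * (L₀ : ℂ) *
        (U 0 1 + U 1 0 + Complex.I * (U 0 0 - U 1 1) * (Real.sin φr : ℂ)) = 0 := by
  rw [hP₁, hP₂, hP₃, ← neg_mul_det_secularMatrix l φr L₀ U hk, mul_eq_zero,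
    or_iff_right (neg_ne_zero.2 hk), ← Matrix.exists_mulVec_eq_zero_iff]
  have hl0 : -l < 0 := neg_neg_of_pos hl
  constructor
  · rintro ⟨ψ, dψ, hψ, hbc⟩
    obtain ⟨a, b, hab, hm, hp⟩ := hψ.exists_eq_helmholtzSol hl hk
    refine ⟨![a, b], fun h => ?_, ?_⟩
    · simp_all
    · rwa [secularMatrix_mulVec, ← (hm (-l) ⟨le_rfl, hl0⟩).1, ← (hm (-l) ⟨le_rfl, hl0⟩).2,
        ← (hp l ⟨hl, le_rfl⟩).1, ← (hp l ⟨hl, le_rfl⟩).2]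
  · rintro ⟨v, hv, hv0⟩
    have hv2 : v = ![v 0, v 1] := by ext i; fin_cases i <;> rfl
    have hab : v 0 ≠ 0 ∨ v 1 ≠ 0 := by
      by_contra! h
      exact hv (by rw [hv2, h.1, h.2]; simp)
    refine ⟨_, _, isEigenfun_ite_helmholtzSol hl hk hab, ?_⟩
    rw [hv2, secularMatrix_mulVec] at hv0
    simpa only [SymBC, if_pos hl0, if_neg hl.not_gt] using hv0
end

section
/- Let l > 0, φ, φ₂ ∈ (−π, π], b₂ ≥ 0 and c₂ ∈ ℝ with 1 + b₂c₂ ≥ 0, and let B₂ be the 2×2 matrix with rows (√(1+b₂c₂)·e^{iφ₂}, b₂) and (c₂, √(1+b₂c₂)·e^{−iφ₂}). For k ∈ ℂ with k ≠ 0, there exists a (φ, k²)-eigenfunction ψ on (−l, l) satisfying the connected PT-symmetric boundary conditions (ψ(l), ψ'(l))ᵀ = B₂·(ψ(−l), ψ'(−l))ᵀ at ±l if and only if cos φ·[ (b₂k² − c₂)·sin(2kl) + 2k·√(1+b₂c₂)·cos φ₂·cos(2kl) ] + 2k·[ √(1+b₂c₂)·sin φ·sin φ₂ − 1 ] = 0.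 -/
open MeasureTheory Filter Topology

/-- Solutions of `-f'' = k² f` on a convex set are determined by their limits and those of
their derivative at `0`. -/
theorem eq_cos_add_sin_of_tendsto {s : Set ℝ} (hs : Convex ℝ s) {F : Filter ℝ} [F.NeBot]
    (hF : F ≤ 𝓝 0) (hFs : s ∈ F) {k : ℂ} (hk : k ≠ 0) {f df : ℝ → ℂ}
    (hf : ∀ x ∈ s, HasDerivWithinAt f (df x) s x)
    (hdf : ∀ x ∈ s, HasDerivWithinAt df (-k ^ 2 * f x) s x) {a b : ℂ}
    (ha : Tendsto f F (𝓝 a)) (hb : Tendsto df F (𝓝 b)) {x : ℝ} (hx : x ∈ s) :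
    f x = a * Complex.cos (k * x) + b * (Complex.sin (k * x) / k) ∧
      df x = -k ^ 2 * a * (Complex.sin (k * x) / k) + b * Complex.cos (k * x) := by
  have hlin (y : ℝ) : HasDerivWithinAt (fun z : ℝ => k * (z : ℂ)) k s y := by
    simpa using ((Complex.ofRealCLM.hasDerivAt (x := y)).const_mul k).hasDerivWithinAt
  have hcos (y : ℝ) : HasDerivWithinAt (fun z : ℝ => Complex.cos (k * z))
      (-Complex.sin (k * y) * k) s y :=
    (Complex.hasDerivAt_cos _).comp_hasDerivWithinAt y (hlin y)
  have hsin (y : ℝ) : HasDerivWithinAt (fun z : ℝ => Complex.sin (k * z))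
      (Complex.cos (k * y) * k) s y :=
    (Complex.hasDerivAt_sin _).comp_hasDerivWithinAt y (hlin y)
  have hconst {g : ℝ → ℂ} (hg : ∀ y ∈ s, HasDerivWithinAt g 0 s y) {c : ℂ}
      (hc : Tendsto g F (𝓝 c)) : g x = c := by
    have h : ∀ y ∈ s, g y = g x := fun y hy => by
      have := hs.norm_image_sub_le_of_norm_hasDerivWithin_le (C := 0) hg (by simp) hx hy
      simpa [sub_eq_zero] using this
    refine tendsto_nhds_unique (tendsto_const_nhds.congr' ?_) hc
    filter_upwards [hFs] with y hy using (h y hy).symm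
  have tcos : Tendsto (fun z : ℝ => Complex.cos (k * z)) F (𝓝 1) := by
    have : Continuous fun z : ℝ => Complex.cos (k * z) := by fun_prop
    simpa using (this.tendsto 0).mono_left hF
  have tsin : Tendsto (fun z : ℝ => Complex.sin (k * z)) F (𝓝 0) := by
    have : Continuous fun z : ℝ => Complex.sin (k * z) := by fun_prop
    simpa using (this.tendsto 0).mono_left hF
  have h₁ : k * f x * Complex.cos (k * x) - df x * Complex.sin (k * x) = k * a := by
    refine hconst (g := fun y => k * f y * Complex.cos (k * y) - df y * Complex.sin (k * y))
      (fun y hy => ?_) ?_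
    · refine HasDerivWithinAt.congr_deriv
        ((((hf y hy).const_mul k).mul (hcos y)).sub ((hdf y hy).mul (hsin y))) ?_
      ring
    · simpa using ((ha.const_mul k).mul tcos).sub (hb.mul tsin)
  have h₂ : k * f x * Complex.sin (k * x) + df x * Complex.cos (k * x) = b := by
    refine hconst (g := fun y => k * f y * Complex.sin (k * y) + df y * Complex.cos (k * y))
      (fun y hy => ?_) ?_
    · refine HasDerivWithinAt.congr_deriv
        ((((hf y hy).const_mul k).mul (hsin y)).add ((hdf y hy).mul (hcos y))) ?_
      ring
    · simpa using ((ha.const_mul k).mul tsin).add (hb.mul tcos)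
  have hsc := Complex.sin_sq_add_cos_sq (k * x)
  constructor
  · field_simp
    linear_combination Complex.cos (k * x) * h₁ + Complex.sin (k * x) * h₂ - k * f x * hsc
  · field_simp
    linear_combination (-Complex.sin (k * x)) * h₁ + Complex.cos (k * x) * h₂ - df x * hsc

theorem hasDerivAt_cos_add_sin {k : ℂ} (hk : k ≠ 0) (a b : ℂ) (x : ℝ) :
    HasDerivAt (fun z : ℝ => a * Complex.cos (k * z) + b * (Complex.sin (k * z) / k))
      (-k ^ 2 * a * (Complex.sin (k * x) / k) + b * Complex.cos (k * x)) x ∧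
    HasDerivAt (fun z : ℝ => -k ^ 2 * a * (Complex.sin (k * z) / k) + b * Complex.cos (k * z))
      (-k ^ 2 * (a * Complex.cos (k * x) + b * (Complex.sin (k * x) / k))) x := by
  have hlin : HasDerivAt (fun z : ℝ => k * (z : ℂ)) k x := by
    simpa using (Complex.ofRealCLM.hasDerivAt (x := x)).const_mul k
  have hcos : HasDerivAt (fun z : ℝ => Complex.cos (k * z)) (-Complex.sin (k * x) * k) x :=
    (Complex.hasDerivAt_cos _).comp x hlin
  have hsin : HasDerivAt (fun z : ℝ => Complex.sin (k * z) / k)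
      (Complex.cos (k * x) * k / k) x :=
    ((Complex.hasDerivAt_sin _).comp x hlin).div_const k
  constructor
  · refine HasDerivAt.congr_deriv ((hcos.const_mul a).add (hsin.const_mul b)) ?_
    field_simp
  · refine HasDerivAt.congr_deriv ((hsin.const_mul (-k ^ 2 * a)).add (hcos.const_mul b)) ?_
    field_simp
    ring

/-- The matrix `T D - B T⁻¹`, where `T` propagates Cauchy data of `-f'' = k² f` over length `l`
(`C = cos kl`, `S = sin kl / k`), `D = diag(p, q)`, and `B = !![σ r, β; γ, σ t]`. -/
def matchingMatrix (k C S p q r t σ β γ : ℂ) : Matrix (Fin 2) (Fin 2) ℂ :=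
  !![C * p - (σ * r * C + β * k ^ 2 * S), S * q - (-(σ * r * S) + β * C);
     -k ^ 2 * S * p - (γ * C + σ * t * k ^ 2 * S), C * q - (-(γ * S) + σ * t * C)]

theorem det_matchingMatrix {k C S p q r t σ β γ : ℂ} (hpq : p * q = 1) (hrt : r * t = 1)
    (hσ : σ ^ 2 = 1 + β * γ) (hN : C ^ 2 + k ^ 2 * S ^ 2 = 1) :
    (matchingMatrix k C S p q r t σ β γ).det =
      2 - ((p + q) / 2 * ((β * k ^ 2 - γ) * (2 * S * C) + σ * (r + t) * (C ^ 2 - k ^ 2 * S ^ 2))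
        - (p - q) * (r - t) / 2 * σ) := by
  rw [matchingMatrix, Matrix.det_fin_two_of]
  linear_combination (C ^ 2 + k ^ 2 * S ^ 2) * (hpq + σ ^ 2 * hrt + hσ) +
    (2 + (p - q) * (r - t) / 2 * σ) * hN

theorem secular_eq_mul_det {l φr φ₂ b₂ c₂ : ℝ} (hb₂c₂ : 0 ≤ 1 + b₂ * c₂) {k : ℂ} (hk : k ≠ 0) :
    (Real.cos φr : ℂ) *
        (((b₂ : ℂ) * k ^ 2 - (c₂ : ℂ)) * Complex.sin (2 * k * l) +
          2 * k * (Real.sqrt (1 + b₂ * c₂) : ℂ) * (Real.cos φ₂ : ℂ) *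
            Complex.cos (2 * k * l)) +
      2 * k * ((Real.sqrt (1 + b₂ * c₂) : ℂ) * (Real.sin φr : ℂ) * (Real.sin φ₂ : ℂ) - 1) =
    -k * (matchingMatrix k (Complex.cos (k * l)) (Complex.sin (k * l) / k)
      (Complex.exp (Complex.I * φr)) (Complex.exp (-(Complex.I * φr)))
      (Complex.exp (Complex.I * φ₂)) (Complex.exp (-(Complex.I * φ₂)))
      (Real.sqrt (1 + b₂ * c₂)) b₂ c₂).det := by
  have hexp (z : ℂ) : Complex.exp z * Complex.exp (-z) = 1 := by
    rw [← Complex.exp_add, add_neg_cancel, Complex.exp_zero]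
  have hσ : (Real.sqrt (1 + b₂ * c₂) : ℂ) ^ 2 = 1 + b₂ * c₂ := by
    exact_mod_cast Real.sq_sqrt hb₂c₂
  have hsc := Complex.sin_sq_add_cos_sq (k * l)
  rw [det_matchingMatrix (hexp _) (hexp _) hσ (by field_simp; linear_combination hsc)]
  have hp (θ : ℝ) : Complex.exp (Complex.I * θ) = Complex.cos θ + Complex.sin θ * Complex.I := by
    rw [mul_comm, Complex.exp_mul_I]
  have hq (θ : ℝ) : Complex.exp (-(Complex.I * θ)) =
      Complex.cos θ - Complex.sin θ * Complex.I := by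
    rw [show -(Complex.I * θ) = (-θ : ℂ) * Complex.I by ring, Complex.exp_mul_I,
      Complex.cos_neg, Complex.sin_neg]
    ring
  rw [hp, hp, hq, hq, show 2 * k * l = 2 * (k * l) by ring, Complex.sin_two_mul,
    Complex.cos_two_mul']
  push_cast
  field_simp
  linear_combination (4 * k * Complex.sin φr * Complex.sin φ₂ *
    (Real.sqrt (1 + b₂ * c₂) : ℂ)) * Complex.I_sq

theorem boundary_condition_iff {k C S p q r t σ β γ a b : ℂ} :
    (![C * (p * a) + S * (q * b), -k ^ 2 * S * (p * a) + C * (q * b)] =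
      (!![σ * r, β; γ, σ * t]).mulVec ![C * a - S * b, k ^ 2 * S * a + C * b]) ↔
    (matchingMatrix k C S p q r t σ β γ).mulVec ![a, b] = 0 := by
  simp only [matchingMatrix, funext_iff, Fin.forall_fin_two, Matrix.mulVec, dotProduct,
    Fin.sum_univ_two, Matrix.of_apply, Matrix.cons_val_zero, Matrix.cons_val_one,
    Pi.zero_apply]
  constructor <;> rintro ⟨h₁, h₂⟩ <;>
    exact ⟨by linear_combination h₁, by linear_combination h₂⟩

/-- The values at `±l` of an eigenfunction in terms of its nontrivial Cauchy data at `0-`. -/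
theorem IsEigenfun.exists_cauchyData {l φr : ℝ} (hl : 0 < l) {k : ℂ} (hk : k ≠ 0)
    {ψ dψ : ℝ → ℂ} (h : IsEigenfun l φr (k ^ 2) ψ dψ) :
    ∃ a b : ℂ, ![a, b] ≠ 0 ∧
      (![ψ l, dψ l] = ![Complex.cos (k * l) * (Complex.exp (Complex.I * φr) * a) +
          Complex.sin (k * l) / k * (Complex.exp (-(Complex.I * φr)) * b),
        -k ^ 2 * (Complex.sin (k * l) / k) * (Complex.exp (Complex.I * φr) * a) +
          Complex.cos (k * l) * (Complex.exp (-(Complex.I * φr)) * b)]) ∧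
      (![ψ (-l), dψ (-l)] = ![Complex.cos (k * l) * a - Complex.sin (k * l) / k * b,
        k ^ 2 * (Complex.sin (k * l) / k) * a + Complex.cos (k * l) * b]) := by
  obtain ⟨⟨x, ⟨hx, hx0⟩, hψx⟩, h₁, h₂, h₃, h₄, a', a, b', b, ha', ha, hb', hb, rfl, rfl⟩ := h
  have hneg {y : ℝ} := eq_cos_add_sin_of_tendsto (x := y) (convex_Ico (-l) 0) nhdsWithin_le_nhds
    (Ico_mem_nhdsLT (neg_lt_zero.2 hl)) hk h₁ h₂ ha hb
  have hpos {y : ℝ} := eq_cos_add_sin_of_tendsto (x := y) (convex_Ioc 0 l) nhdsWithin_le_nhds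
    (Ioc_mem_nhdsGT hl) hk h₃ h₄ ha' hb'
  refine ⟨a, b, fun hab => hψx ?_, ?_, ?_⟩
  · have ha0 : a = 0 := congrFun hab 0
    have hb0 : b = 0 := congrFun hab 1
    subst ha0 hb0
    rcases lt_or_gt_of_ne hx0 with hlt | hgt
    · simpa using (hneg ⟨hx.1, hlt⟩).1
    · simpa using (hpos ⟨hgt, hx.2⟩).1
  · obtain ⟨e₁, e₂⟩ := hpos ⟨hl, le_rfl⟩
    rw [e₁, e₂]
    refine congrArg₂ (fun u v => ![u, v]) ?_ ?_ <;> ring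
  · obtain ⟨e₁, e₂⟩ := hneg ⟨le_rfl, neg_lt_zero.2 hl⟩
    rw [e₁, e₂]
    simp only [Complex.ofReal_neg, mul_neg, Complex.cos_neg, Complex.sin_neg, neg_div]
    refine congrArg₂ (fun u v => ![u, v]) ?_ ?_ <;> ring

/-- Any nontrivial Cauchy data at `0-` extend to an eigenfunction. -/
theorem exists_isEigenfun_of_cauchyData {l : ℝ} (φr : ℝ) (hl : 0 < l) {k : ℂ} (hk : k ≠ 0)
    {a b : ℂ} (hab : ![a, b] ≠ 0) :
    ∃ ψ dψ : ℝ → ℂ, IsEigenfun l φr (k ^ 2) ψ dψ ∧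
      (![ψ l, dψ l] = ![Complex.cos (k * l) * (Complex.exp (Complex.I * φr) * a) +
          Complex.sin (k * l) / k * (Complex.exp (-(Complex.I * φr)) * b),
        -k ^ 2 * (Complex.sin (k * l) / k) * (Complex.exp (Complex.I * φr) * a) +
          Complex.cos (k * l) * (Complex.exp (-(Complex.I * φr)) * b)]) ∧
      (![ψ (-l), dψ (-l)] = ![Complex.cos (k * l) * a - Complex.sin (k * l) / k * b,
        k ^ 2 * (Complex.sin (k * l) / k) * a + Complex.cos (k * l) * b]) := by
  set f : ℂ → ℂ → ℝ → ℂ := fun a b z =>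
    a * Complex.cos (k * z) + b * (Complex.sin (k * z) / k) with hf
  set df : ℂ → ℂ → ℝ → ℂ := fun a b z =>
    -k ^ 2 * a * (Complex.sin (k * z) / k) + b * Complex.cos (k * z) with hdf
  have hder (a b : ℂ) (x : ℝ) : HasDerivAt (f a b) (df a b x) x ∧
      HasDerivAt (df a b) (-k ^ 2 * f a b x) x := hasDerivAt_cos_add_sin hk a b x
  set a' := Complex.exp (Complex.I * φr) * a
  set b' := Complex.exp (-(Complex.I * φr)) * b
  set ψ : ℝ → ℂ := fun x => if x < 0 then f a b x else f a' b' x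
  set dψ : ℝ → ℂ := fun x => if x < 0 then df a b x else df a' b' x
  have hψn {x : ℝ} (hx : x < 0) : ψ x = f a b x := if_pos hx
  have hdψn {x : ℝ} (hx : x < 0) : dψ x = df a b x := if_pos hx
  have hψp {x : ℝ} (hx : 0 < x) : ψ x = f a' b' x := if_neg hx.not_gt
  have hdψp {x : ℝ} (hx : 0 < x) : dψ x = df a' b' x := if_neg hx.not_gt
  have tf (a b : ℂ) : Tendsto (f a b) (𝓝 0) (𝓝 a) := by
    simpa [hf] using (hder a b 0).1.continuousAt.tendsto
  have tdf (a b : ℂ) : Tendsto (df a b) (𝓝 0) (𝓝 b) := by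
    simpa [hdf] using (hder a b 0).2.continuousAt.tendsto
  refine ⟨ψ, dψ, ⟨?_, fun x hx => ?_, fun x hx => ?_, fun x hx => ?_, fun x hx => ?_,
    a', a, b', b, ?_, ?_, ?_, ?_, rfl, rfl⟩, ?_, ?_⟩
  · by_contra! hzero
    have hev : ∀ᶠ x in 𝓝[<] (0 : ℝ), f a b x = 0 ∧ df a b x = 0 := by
      filter_upwards [Ioo_mem_nhdsLT (neg_lt_zero.2 hl)] with x hx
      have hfx : ∀ y ∈ Set.Ioo (-l) 0, f a b y = 0 := fun y hy =>
        hψn hy.2 ▸ hzero y ⟨⟨hy.1.le, hy.2.le.trans hl.le⟩, hy.2.ne⟩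
      refine ⟨hfx x hx, (hder a b x).1.unique ?_⟩
      refine (hasDerivAt_const x (0 : ℂ)).congr_of_eventuallyEq ?_
      filter_upwards [isOpen_Ioo.mem_nhds hx] with y hy using hfx y hy
    have ha0 : a = 0 := tendsto_nhds_unique ((tf a b).mono_left nhdsWithin_le_nhds)
      (tendsto_const_nhds.congr' (hev.mono fun x hx => hx.1.symm))
    have hb0 : b = 0 := tendsto_nhds_unique ((tdf a b).mono_left nhdsWithin_le_nhds)
      (tendsto_const_nhds.congr' (hev.mono fun x hx => hx.2.symm))
    exact hab (by simp [ha0, hb0])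
  · rw [hdψn hx.2]
    exact (hder a b x).1.hasDerivWithinAt.congr (fun y hy => hψn hy.2) (hψn hx.2)
  · rw [hψn hx.2]
    exact (hder a b x).2.hasDerivWithinAt.congr (fun y hy => hdψn hy.2) (hdψn hx.2)
  · rw [hdψp hx.1]
    exact (hder a' b' x).1.hasDerivWithinAt.congr (fun y hy => hψp hy.1) (hψp hx.1)
  · rw [hψp hx.1]
    exact (hder a' b' x).2.hasDerivWithinAt.congr (fun y hy => hdψp hy.1) (hdψp hx.1)
  · exact ((tf a' b').mono_left nhdsWithin_le_nhds).congr'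
      (eventually_nhdsWithin_of_forall fun x hx => (hψp hx).symm)
  · exact ((tf a b).mono_left nhdsWithin_le_nhds).congr'
      (eventually_nhdsWithin_of_forall fun x hx => (hψn hx).symm)
  · exact ((tdf a' b').mono_left nhdsWithin_le_nhds).congr'
      (eventually_nhdsWithin_of_forall fun x hx => (hdψp hx).symm)
  · exact ((tdf a b).mono_left nhdsWithin_le_nhds).congr'
      (eventually_nhdsWithin_of_forall fun x hx => (hdψn hx).symm)
  · rw [hψp hl, hdψp hl]
    simp only [hf, hdf]
    refine congrArg₂ (fun u v => ![u, v]) ?_ ?_ <;> ring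
  · rw [hψn (neg_lt_zero.2 hl), hdψn (neg_lt_zero.2 hl)]
    simp only [hf, hdf, Complex.ofReal_neg, mul_neg, Complex.cos_neg, Complex.sin_neg, neg_div]
    refine congrArg₂ (fun u v => ![u, v]) ?_ ?_ <;> ring

/-- secular equation for the point interaction of parameter `φ` at the
origin with a second connected PT-symmetric point interaction `B₂` (parameters
`b₂, c₂, φ₂`, `θ₂ = 0`) linking the endpoints `±l`: for `k ≠ 0`, a `(φ, k²)`-eigenfunction
with `(ψ(l), ψ'(l))ᵀ = B₂ (ψ(-l), ψ'(-l))ᵀ` exists iff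
`cos φ [(b₂k² - c₂) sin 2kl + 2k√(1+b₂c₂) cos φ₂ cos 2kl] + 2k[√(1+b₂c₂) sin φ sin φ₂ - 1] = 0`. -/
theorem surprising_spectra_stmt17
    (l : ℝ) (hl : 0 < l)
    (φr φ₂ : ℝ) (hφr : φr ∈ Set.Ioc (-Real.pi) Real.pi)
    (hφ₂ : φ₂ ∈ Set.Ioc (-Real.pi) Real.pi)
    (b₂ c₂ : ℝ) (hb₂ : 0 ≤ b₂) (hb₂c₂ : 0 ≤ 1 + b₂ * c₂)
    (B₂ : Matrix (Fin 2) (Fin 2) ℂ)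
    (hB₂ : B₂ = !![(Real.sqrt (1 + b₂ * c₂) : ℂ) * Complex.exp (Complex.I * φ₂), (b₂ : ℂ);
                   (c₂ : ℂ), (Real.sqrt (1 + b₂ * c₂) : ℂ) * Complex.exp (-(Complex.I * φ₂))])
    (k : ℂ) (hk : k ≠ 0) :
    (∃ ψ dψ : ℝ → ℂ, IsEigenfun l φr (k ^ 2) ψ dψ ∧
      ![ψ l, dψ l] = B₂.mulVec ![ψ (-l), dψ (-l)]) ↔
    (Real.cos φr : ℂ) *
        (((b₂ : ℂ) * k ^ 2 - (c₂ : ℂ)) * Complex.sin (2 * k * l) +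
          2 * k * (Real.sqrt (1 + b₂ * c₂) : ℂ) * (Real.cos φ₂ : ℂ) *
            Complex.cos (2 * k * l)) +
      2 * k * ((Real.sqrt (1 + b₂ * c₂) : ℂ) * (Real.sin φr : ℂ) * (Real.sin φ₂ : ℂ) - 1)
      = 0 := by
  rw [secular_eq_mul_det hb₂c₂ hk, mul_eq_zero, or_iff_right (neg_ne_zero.2 hk),
    ← Matrix.exists_mulVec_eq_zero_iff, hB₂]
  constructor
  · rintro ⟨ψ, dψ, h, hbc⟩
    obtain ⟨a, b, hab, hl₁, hl₂⟩ := h.exists_cauchyData hl hk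
    rw [hl₁, hl₂] at hbc
    exact ⟨_, hab, boundary_condition_iff.1 hbc⟩
  · rintro ⟨v, hv, hMv⟩
    have hv' : v = ![v 0, v 1] := by
      ext i
      fin_cases i <;> rfl
    rw [hv'] at hv hMv
    obtain ⟨ψ, dψ, h, hl₁, hl₂⟩ := exists_isEigenfun_of_cauchyData φr hl hk hv
    refine ⟨ψ, dψ, h, ?_⟩
    rw [hl₁, hl₂]
    exact boundary_condition_iff.2 hMv
end

section
/- Let l > 0, φ ∈ (−π, π], θ ∈ [0, 2π), and h₀, h₁ ∈ ℝ not both zero. Consider the separated PT-symmetric boundary conditions at ±l: h₀·ψ'(l) = h₁·e^{iθ}·ψ(l) and h₀·ψ'(−l) = −h₁·e^{−iθ}·ψ(−l). For k ∈ ℂ with k ≠ 0, there exists a (φ, k²)-eigenfunction on (−l, l) satisfying these conditions at ±l if and only if cos φ·[ 2h₀h₁k·cos(2kl)·cos θ + (h₀²k² − h₁²)·sin(2kl) ] − 2h₀h₁k·sin θ·sin φ = 0. -/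
open MeasureTheory Filter Topology

/-- The separated PT-symmetric boundary conditions at `±l` with parameters
`(h₀ : h₁) ∈ P¹(ℝ)` and phase `θ`:
`h₀ ψ'(l) = h₁ e^{iθ} ψ(l)` and `h₀ ψ'(-l) = -h₁ e^{-iθ} ψ(-l)`. -/
def SepBC (l h₀ h₁ θ : ℝ) (ψ dψ : ℝ → ℂ) : Prop :=
  (h₀ : ℂ) * dψ l = (h₁ : ℂ) * Complex.exp (Complex.I * θ) * ψ l ∧
  (h₀ : ℂ) * dψ (-l) = -(h₁ : ℂ) * Complex.exp (-(Complex.I * θ)) * ψ (-l)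

open Complex in
/-- The solution of `-u'' = k² u` with `u 0 = p`, `u' 0 = q`. -/
noncomputable def cauchySol (k p q : ℂ) (x : ℝ) : ℂ := p * cos (k * x) + q * sin (k * x) / k

open Complex in
/-- The derivative of `cauchySol k p q`. -/
noncomputable def cauchySolDeriv (k p q : ℂ) (x : ℝ) : ℂ := -p * k * sin (k * x) + q * cos (k * x)

lemma hasDerivAt_cauchySol {k : ℂ} (hk : k ≠ 0) (p q : ℂ) (x : ℝ) :
    HasDerivAt (cauchySol k p q) (cauchySolDeriv k p q x) x := by
  refine (((hasDerivAt_cos_mul_ofReal k x).const_mul p).add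
    (((hasDerivAt_sin_mul_ofReal k x).const_mul q).div_const k)).congr_deriv ?_
  unfold cauchySolDeriv
  field_simp

lemma hasDerivAt_cauchySolDeriv {k : ℂ} (hk : k ≠ 0) (p q : ℂ) (x : ℝ) :
    HasDerivAt (cauchySolDeriv k p q) (-k ^ 2 * cauchySol k p q x) x := by
  refine (((hasDerivAt_sin_mul_ofReal k x).const_mul (-p * k)).add
    ((hasDerivAt_cos_mul_ofReal k x).const_mul q)).congr_deriv ?_
  unfold cauchySol
  field_simp
  ring

lemma cauchySol_zero (k p q : ℂ) : cauchySol k p q 0 = p := by simp [cauchySol]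

lemma cauchySolDeriv_zero (k p q : ℂ) : cauchySolDeriv k p q 0 = q := by simp [cauchySolDeriv]

/-- A nontrivial solution does not vanish identically on an open interval. -/
lemma exists_cauchySol_ne_zero {k p q : ℂ} (hk : k ≠ 0) (hpq : ¬ (p = 0 ∧ q = 0)) {a b : ℝ}
    (hab : a < b) : ∃ x ∈ Set.Ioo a b, cauchySol k p q x ≠ 0 := by
  by_contra! h
  obtain ⟨x, hx⟩ := Set.nonempty_Ioo.2 hab
  have h0 := h x hx
  have h1 : cauchySolDeriv k p q x = 0 := by
    refine (hasDerivAt_cauchySol hk p q x).unique ((hasDerivAt_const x (0 : ℂ)).congr_of_eventuallyEq ?_)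
    filter_upwards [Ioo_mem_nhds hx.1 hx.2] with y hy using h y hy
  have hs := Complex.sin_sq_add_cos_sq (k * x)
  unfold cauchySol at h0
  unfold cauchySolDeriv at h1
  field_simp at h0
  refine hpq ⟨?_, ?_⟩
  · refine (mul_eq_zero.1 (?_ : k * p = 0)).resolve_left hk
    linear_combination Complex.cos (k * x) * h0 - Complex.sin (k * x) * h1 - p * k * hs
  · linear_combination Complex.sin (k * x) * h0 + Complex.cos (k * x) * h1 - q * hs

/-- A function with zero derivative on a convex set and a limit at a limit point of the set equals
this limit on the set. -/
lemma eq_limit_of_hasDerivWithinAt_zero {S : Set ℝ} (hS : Convex ℝ S) {f : ℝ → ℂ} {a : ℝ} {c : ℂ}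
    [NeBot (𝓝[S] a)] (hf : ∀ x ∈ S, HasDerivWithinAt f 0 S x) (hc : Tendsto f (𝓝[S] a) (𝓝 c))
    {x : ℝ} (hx : x ∈ S) : f x = c := by
  refine tendsto_nhds_unique (tendsto_const_nhds.congr' ?_) hc
  filter_upwards [self_mem_nhdsWithin] with y hy
  have h := hS.norm_image_sub_le_of_norm_hasDerivWithin_le (C := 0) hf (by simp) hx hy
  rw [zero_mul] at h
  exact (sub_eq_zero.1 (norm_le_zero_iff.1 h)).symm

/-- A solution of `-u'' = k² u` on a convex set is determined by its limits at `0`. -/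
lemma eq_cauchySol_of_hasDerivWithinAt {S : Set ℝ} (hS : Convex ℝ S) [NeBot (𝓝[S] (0 : ℝ))]
    {k p q : ℂ} (hk : k ≠ 0) {u v : ℝ → ℂ}
    (hu : ∀ x ∈ S, HasDerivWithinAt u (v x) S x)
    (hv : ∀ x ∈ S, HasDerivWithinAt v (-k ^ 2 * u x) S x)
    (hp : Tendsto u (𝓝[S] 0) (𝓝 p)) (hq : Tendsto v (𝓝[S] 0) (𝓝 q)) {x : ℝ} (hx : x ∈ S) :
    u x = cauchySol k p q x ∧ v x = cauchySolDeriv k p q x := by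
  have hcos : Tendsto (fun y : ℝ => Complex.cos (k * y)) (𝓝[S] 0) (𝓝 1) := by
    have h := (hasDerivAt_cos_mul_ofReal k 0).continuousAt.tendsto
    simp only [Complex.ofReal_zero, mul_zero, Complex.cos_zero] at h
    exact h.mono_left nhdsWithin_le_nhds
  have hsin : Tendsto (fun y : ℝ => Complex.sin (k * y)) (𝓝[S] 0) (𝓝 0) := by
    have h := (hasDerivAt_sin_mul_ofReal k 0).continuousAt.tendsto
    simp only [Complex.ofReal_zero, mul_zero, Complex.sin_zero] at h
    exact h.mono_left nhdsWithin_le_nhds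
  have h1 : k * u x * Complex.cos (k * x) - v x * Complex.sin (k * x) = k * p * 1 - q * 0 := by
    refine eq_limit_of_hasDerivWithinAt_zero hS (a := 0)
      (f := fun y => k * u y * Complex.cos (k * y) - v y * Complex.sin (k * y))
      (fun y hy => ?_) (((hp.const_mul k).mul hcos).sub (hq.mul hsin)) hx
    refine ((((hu y hy).const_mul k).mul (hasDerivAt_cos_mul_ofReal k y).hasDerivWithinAt).sub
      ((hv y hy).mul (hasDerivAt_sin_mul_ofReal k y).hasDerivWithinAt)).congr_deriv ?_
    ring
  have h2 : k * u x * Complex.sin (k * x) + v x * Complex.cos (k * x) = k * p * 0 + q * 1 := by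
    refine eq_limit_of_hasDerivWithinAt_zero hS (a := 0)
      (f := fun y => k * u y * Complex.sin (k * y) + v y * Complex.cos (k * y))
      (fun y hy => ?_) (((hp.const_mul k).mul hsin).add (hq.mul hcos)) hx
    refine ((((hu y hy).const_mul k).mul (hasDerivAt_sin_mul_ofReal k y).hasDerivWithinAt).add
      ((hv y hy).mul (hasDerivAt_cos_mul_ofReal k y).hasDerivWithinAt)).congr_deriv ?_
    ring
  have hs := Complex.sin_sq_add_cos_sq (k * x)
  constructor
  · unfold cauchySol
    field_simp
    linear_combination Complex.cos (k * x) * h1 + Complex.sin (k * x) * h2 - k * u x * hs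
  · unfold cauchySolDeriv
    linear_combination -Complex.sin (k * x) * h1 + Complex.cos (k * x) * h2 - v x * hs

/-- A homogeneous `2 × 2` system has a nontrivial solution iff its determinant vanishes. -/
lemma exists_ne_zero_solution_iff {K : Type*} [Field K] (a b c d : K) :
    (∃ p q : K, ¬ (p = 0 ∧ q = 0) ∧ a * p + b * q = 0 ∧ c * p + d * q = 0) ↔
      a * d - b * c = 0 := by
  constructor
  · rintro ⟨p, q, hpq, h1, h2⟩
    by_contra h
    refine hpq ⟨(mul_eq_zero.1 (?_ : (a * d - b * c) * p = 0)).resolve_left h,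
      (mul_eq_zero.1 (?_ : (a * d - b * c) * q = 0)).resolve_left h⟩
    · linear_combination d * h1 - b * h2
    · linear_combination a * h2 - c * h1
  · intro h
    by_cases hab : a = 0 ∧ b = 0
    · by_cases hcd : c = 0 ∧ d = 0
      · exact ⟨1, 0, by simp, by simp [hab.1], by simp [hcd.1]⟩
      · exact ⟨d, -c, by simpa [and_comm] using hcd, by simp [hab.1, hab.2], by ring⟩
    · exact ⟨b, -a, by simpa [and_comm] using hab, by ring, by linear_combination -h⟩

/-- Existence of an eigenfunction, in terms of its one-sided Cauchy data `p`, `q` at `0-`. -/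
lemma exists_eigenfun_iff {l : ℝ} (hl : 0 < l) (φr h₀ h₁ θ : ℝ) {k : ℂ} (hk : k ≠ 0) :
    (∃ ψ dψ : ℝ → ℂ, IsEigenfun l φr (k ^ 2) ψ dψ ∧ SepBC l h₀ h₁ θ ψ dψ) ↔
      ∃ p q : ℂ, ¬ (p = 0 ∧ q = 0) ∧
        (h₀ : ℂ) * cauchySolDeriv k (Complex.exp (Complex.I * φr) * p)
            (Complex.exp (-(Complex.I * φr)) * q) l =
          (h₁ : ℂ) * Complex.exp (Complex.I * θ) *
            cauchySol k (Complex.exp (Complex.I * φr) * p) (Complex.exp (-(Complex.I * φr)) * q) l ∧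
        (h₀ : ℂ) * cauchySolDeriv k p q (-l) =
          -(h₁ : ℂ) * Complex.exp (-(Complex.I * θ)) * cauchySol k p q (-l) := by
  have hl' : -l < 0 := neg_lt_zero.2 hl
  constructor
  · rintro ⟨ψ, dψ, ⟨⟨x, ⟨hx, hx0⟩, hψx⟩, hm, hdm, hp, hdp, a, p, b, q, ha, hpl, hb, hql, rfl, rfl⟩,
      hbp, hbm⟩
    have eqR : 𝓝[Set.Ioc 0 l] (0 : ℝ) = 𝓝[>] 0 := nhdsWithin_Ioc_eq_nhdsGT hl
    have eqL : 𝓝[Set.Ico (-l) 0] (0 : ℝ) = 𝓝[<] 0 := nhdsWithin_Ico_eq_nhdsLT hl'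
    have neR : (𝓝[Set.Ioc 0 l] (0 : ℝ)).NeBot := by rw [eqR]; infer_instance
    have neL : (𝓝[Set.Ico (-l) 0] (0 : ℝ)).NeBot := by rw [eqL]; infer_instance
    rw [← eqR] at ha hb
    rw [← eqL] at hpl hql
    have hR := fun y hy => eq_cauchySol_of_hasDerivWithinAt (convex_Ioc 0 l) hk hp hdp ha hb (x := y) hy
    have hL := fun y hy =>
      eq_cauchySol_of_hasDerivWithinAt (convex_Ico (-l) 0) hk hm hdm hpl hql (x := y) hy
    refine ⟨p, q, ?_, ?_, ?_⟩
    · rintro ⟨rfl, rfl⟩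
      rcases lt_or_gt_of_ne hx0 with h | h
      · exact hψx (by simp [(hL x ⟨hx.1, h⟩).1, cauchySol])
      · exact hψx (by simp [(hR x ⟨h, hx.2⟩).1, cauchySol])
    · have := hR l ⟨hl, le_rfl⟩
      rwa [← this.1, ← this.2]
    · have := hL (-l) ⟨le_rfl, hl'⟩
      rwa [← this.1, ← this.2]
  · rintro ⟨p, q, hpq, hbp, hbm⟩
    set a := Complex.exp (Complex.I * φr) * p with ha
    set b := Complex.exp (-(Complex.I * φr)) * q with hb
    set ψ : ℝ → ℂ := fun x => if x < 0 then cauchySol k p q x else cauchySol k a b x with hψ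
    set dψ : ℝ → ℂ := fun x => if x < 0 then cauchySolDeriv k p q x else cauchySolDeriv k a b x
      with hdψ
    have ψm : ∀ {x : ℝ}, x < 0 → ψ x = cauchySol k p q x := fun h => if_pos h
    have ψp : ∀ {x : ℝ}, 0 < x → ψ x = cauchySol k a b x := fun h => if_neg h.le.not_gt
    have dψm : ∀ {x : ℝ}, x < 0 → dψ x = cauchySolDeriv k p q x := fun h => if_pos h
    have dψp : ∀ {x : ℝ}, 0 < x → dψ x = cauchySolDeriv k a b x := fun h => if_neg h.le.not_gt
    have lim : ∀ {f : ℝ → ℂ} {f' c : ℂ} (S : Set ℝ) {g : ℝ → ℂ}, HasDerivAt f f' 0 → f 0 = c →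
        (∀ y ∈ S, g y = f y) → Tendsto g (𝓝[S] 0) (𝓝 c) := by
      rintro f f' _ S g hf rfl hg
      refine (hf.continuousAt.tendsto.mono_left nhdsWithin_le_nhds).congr' ?_
      filter_upwards [self_mem_nhdsWithin] with y hy using (hg y hy).symm
    refine ⟨ψ, dψ, ⟨?_, fun x hx => ?_, fun x hx => ?_, fun x hx => ?_, fun x hx => ?_,
      a, p, b, q, ?_, ?_, ?_, ?_, ha, hb⟩, ?_, ?_⟩
    · obtain ⟨x, hx, h⟩ := exists_cauchySol_ne_zero hk hpq hl'
      exact ⟨x, ⟨⟨hx.1.le, hx.2.le.trans hl.le⟩, hx.2.ne⟩, by rwa [ψm hx.2]⟩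
    · rw [dψm hx.2]
      exact (hasDerivAt_cauchySol hk p q x).hasDerivWithinAt.congr (fun y hy => ψm hy.2) (ψm hx.2)
    · rw [ψm hx.2]
      exact (hasDerivAt_cauchySolDeriv hk p q x).hasDerivWithinAt.congr
        (fun y hy => dψm hy.2) (dψm hx.2)
    · rw [dψp hx.1]
      exact (hasDerivAt_cauchySol hk a b x).hasDerivWithinAt.congr (fun y hy => ψp hy.1) (ψp hx.1)
    · rw [ψp hx.1]
      exact (hasDerivAt_cauchySolDeriv hk a b x).hasDerivWithinAt.congr
        (fun y hy => dψp hy.1) (dψp hx.1)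
    · exact lim _ (hasDerivAt_cauchySol hk a b 0) (cauchySol_zero k a b) fun y hy => ψp hy
    · exact lim _ (hasDerivAt_cauchySol hk p q 0) (cauchySol_zero k p q) fun y hy => ψm hy
    · exact lim _ (hasDerivAt_cauchySolDeriv hk a b 0) (cauchySolDeriv_zero k a b) fun y hy => dψp hy
    · exact lim _ (hasDerivAt_cauchySolDeriv hk p q 0) (cauchySolDeriv_zero k p q) fun y hy => dψm hy
    · rwa [dψp hl, ψp hl]
    · rwa [dψm hl', ψm hl']

/-- secular equation for the point interaction of parameter `φ` at the
origin with separated PT-symmetric boundary conditions at `±l`: for `k ≠ 0`, a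
`(φ, k²)`-eigenfunction satisfying them exists iff
`cos φ [2h₀h₁k cos 2kl cos θ + (h₀²k² - h₁²) sin 2kl] - 2h₀h₁k sin θ sin φ = 0`. -/
theorem surprising_spectra_stmt18
    (l : ℝ) (hl : 0 < l) (φr : ℝ) (hφr : φr ∈ Set.Ioc (-Real.pi) Real.pi)
    (θ : ℝ) (hθ : θ ∈ Set.Ico 0 (2 * Real.pi))
    (h₀ h₁ : ℝ) (hh : ¬ (h₀ = 0 ∧ h₁ = 0))
    (k : ℂ) (hk : k ≠ 0) :
    (∃ ψ dψ : ℝ → ℂ, IsEigenfun l φr (k ^ 2) ψ dψ ∧ SepBC l h₀ h₁ θ ψ dψ) ↔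
    (Real.cos φr : ℂ) *
        (2 * (h₀ : ℂ) * (h₁ : ℂ) * k * Complex.cos (2 * k * l) * (Real.cos θ : ℂ) +
          ((h₀ : ℂ) ^ 2 * k ^ 2 - (h₁ : ℂ) ^ 2) * Complex.sin (2 * k * l)) -
      2 * (h₀ : ℂ) * (h₁ : ℂ) * k * (Real.sin θ : ℂ) * (Real.sin φr : ℂ) = 0 := by
  rw [exists_eigenfun_iff hl φr h₀ h₁ θ hk]
  have e1 : Complex.exp (Complex.I * φr) = Complex.cos φr + Complex.sin φr * Complex.I := by
    rw [mul_comm, Complex.exp_mul_I]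
  have e2 : Complex.exp (-(Complex.I * φr)) = Complex.cos φr - Complex.sin φr * Complex.I := by
    rw [← mul_neg, mul_comm, Complex.exp_mul_I, Complex.cos_neg, Complex.sin_neg]; ring
  have t1 : Complex.exp (Complex.I * θ) = Complex.cos θ + Complex.sin θ * Complex.I := by
    rw [mul_comm, Complex.exp_mul_I]
  have t2 : Complex.exp (-(Complex.I * θ)) = Complex.cos θ - Complex.sin θ * Complex.I := by
    rw [← mul_neg, mul_comm, Complex.exp_mul_I, Complex.cos_neg, Complex.sin_neg]; ring
  have hc : Complex.cos (2 * k * l) = Complex.cos (k * l) ^ 2 - Complex.sin (k * l) ^ 2 := by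
    rw [mul_assoc, Complex.cos_two_mul]
    linear_combination Complex.sin_sq_add_cos_sq (k * l)
  have hs : Complex.sin (2 * k * l) = 2 * Complex.sin (k * l) * Complex.cos (k * l) := by
    rw [mul_assoc, Complex.sin_two_mul]
  rw [hc, hs, Complex.ofReal_cos, Complex.ofReal_sin, Complex.ofReal_cos, Complex.ofReal_sin]
  simp only [cauchySol, cauchySolDeriv, Complex.ofReal_neg, mul_neg, Complex.cos_neg,
    Complex.sin_neg, e1, e2, t1, t2]
  have hS := Complex.sin_sq_add_cos_sq (k * l)
  have hT := Complex.sin_sq_add_cos_sq (θ : ℂ)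
  have hI := Complex.I_sq
  generalize Complex.cos (k * l) = c at *
  generalize Complex.sin (k * l) = s at *
  generalize Complex.cos (φr : ℂ) = C at *
  generalize Complex.sin (φr : ℂ) = S at *
  generalize Complex.cos (θ : ℂ) = T at *
  generalize Complex.sin (θ : ℂ) = U at *
  generalize Complex.I = i at *
  generalize (h₀ : ℂ) = x at *
  generalize (h₁ : ℂ) = y at *
  refine Iff.trans (exists₂_congr fun p q => and_congr_right fun _ => ?_)
    ((exists_ne_zero_solution_iff
      (k * (C + S * i) * (-x * k * s - y * (T + U * i) * c))
      ((C - S * i) * (x * k * c - y * (T + U * i) * s))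
      (k * (x * k * s + y * (T - U * i) * c)) (x * k * c - y * (T - U * i) * s)).trans ?_)
  · refine and_congr ?_ ?_
    · field_simp
      constructor <;> intro h
      · linear_combination h
      · linear_combination h
    · field_simp
      constructor <;> intro h
      · linear_combination h
      · linear_combination h
  · have h : k * (C + S * i) * (-x * k * s - y * (T + U * i) * c) * (x * k * c - y * (T - U * i) * s) -
        (C - S * i) * (x * k * c - y * (T + U * i) * s) * (k * (x * k * s + y * (T - U * i) * c)) =
        -k * (C * (2 * x * y * k * (c ^ 2 - s ^ 2) * T + (x ^ 2 * k ^ 2 - y ^ 2) * (2 * s * c)) -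
          2 * x * y * k * U * S) := by
      linear_combination 2 * C * k * y ^ 2 * s * c * (hT - U ^ 2 * hI) -
        2 * x * k ^ 2 * y * S * U * ((c ^ 2 + s ^ 2) * hI - hS)
    rw [h, mul_eq_zero, or_iff_right (neg_ne_zero.2 hk)]
end
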